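/- The sequence p(2,n) satisfies Benford's Law in every integer base b ≥ 2: for every base b ≥ 2 and all real numbers 0 ≤ α < β ≤ 1, the limit as N → ∞ of (1/N)·#{1 ≤ n ≤ N : the fractional part of log_b(p(2,n)) lies in [α, β)} equals β − α; equivalently, the fractional parts of log_b(p(2,n)) are equidistributed modulo 1. -/

import Mathlib

/-- A rectangle with integer corners: `(a, b, c, d)` represents `[a,b] × [c,d] ⊆ ℝ²`
(with `a < b`, `c < d` required in `IsTiling`). -/
abbrev Rect : Type := ℕ × ℕ × ℕ × ℕ

/-- The unit cell `[i,i+1] × [j,j+1]` lies inside the rectangle `R`. -/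
def cellIn (R : Rect) (i j : ℕ) : Prop :=
  R.1 ≤ i ∧ i < R.2.1 ∧ R.2.2.1 ≤ j ∧ j < R.2.2.2

/-- `T` is a tiling of `[0,m] × [0,n]`: each rectangle has positive integer side lengths
and lies inside `[0,m] × [0,n]`, and every unit cell of `[0,m] × [0,n]` is covered by
exactly one rectangle of `T` (equivalently, the rectangles have pairwise disjoint
interiors and their union is `[0,m] × [0,n]`). -/
def IsTiling (m n : ℕ) (T : Finset Rect) : Prop :=
  (∀ R ∈ T, R.1 < R.2.1 ∧ R.2.1 ≤ m ∧ R.2.2.1 < R.2.2.2 ∧ R.2.2.2 ≤ n) ∧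
  ∀ i < m, ∀ j < n, ∃! R, R ∈ T ∧ cellIn R i j

/-- The block of a rectangle: the unordered pair of its side lengths,
recorded as a sorted pair `(min, max)`. -/
def blockOf (R : Rect) : ℕ × ℕ :=
  (min (R.2.1 - R.1) (R.2.2.2 - R.2.2.1), max (R.2.1 - R.1) (R.2.2.2 - R.2.2.1))

/-- The block multiset of a tiling. -/
def blocksOf (T : Finset Rect) : Multiset (ℕ × ℕ) := T.val.map blockOf

/-- The number of distinct block multisets of tilings of `[0,m] × [0,n]` all of whose
blocks satisfy the predicate `allowed` (as sorted pairs of side lengths). -/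
noncomputable def rectPA (m n : ℕ) (allowed : ℕ × ℕ → Prop) : ℕ :=
  Nat.card {M : Multiset (ℕ × ℕ) |
    ∃ T : Finset Rect, IsTiling m n T ∧ blocksOf T = M ∧ ∀ b ∈ M, allowed b}

/-- The rectangular partition function `p(m,n)`: the number of distinct block multisets
of tilings of `[0,m] × [0,n]`. -/
noncomputable def rectP (m n : ℕ) : ℕ :=
  Nat.card {M : Multiset (ℕ × ℕ) | ∃ T : Finset Rect, IsTiling m n T ∧ blocksOf T = M}

/-- The Euler partition function `p(n)`. -/
def eulerP (n : ℕ) : ℕ := Fintype.card (Nat.Partition n)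

/-- `p_{k,l}(2,n)`: the number of distinct block multisets of tilings of `[0,2] × [0,n]`
using only blocks with side lengths `{1,i}` for `1 ≤ i ≤ k` or `{2,j}` for `2 ≤ j ≤ l`. -/
noncomputable def pkl (k l n : ℕ) : ℕ :=
  rectPA 2 n (fun b => (b.1 = 1 ∧ 1 ≤ b.2 ∧ b.2 ≤ k) ∨ (b.1 = 2 ∧ 2 ≤ b.2 ∧ b.2 ≤ l))

lemma card_arith_progression_Ico {x d u v : ℝ} (hd : 0 < d) (hxu : x ≤ u) {H : ℕ}
    (hv : v ≤ x + H * d) :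
    (v - u) / d - 1 ≤
      (((Finset.range H).filter (fun h : ℕ => x + h * d ∈ Set.Ico u v)).card : ℝ) := by
  have hsub : Finset.Ico ⌈(u - x) / d⌉₊ ⌈(v - x) / d⌉₊ ⊆
      (Finset.range H).filter (fun h : ℕ => x + h * d ∈ Set.Ico u v) := by
    intro h hh
    rw [Finset.mem_Ico, Nat.ceil_le, Nat.lt_ceil, div_le_iff₀ hd, lt_div_iff₀ hd] at hh
    rw [Finset.mem_filter, Finset.mem_range, Set.mem_Ico]
    refine ⟨?_, by linarith, by linarith⟩
    have : (h : ℝ) * d < H * d := by linarith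
    exact_mod_cast lt_of_mul_lt_mul_right this hd.le
  have hcard := Finset.card_le_card hsub
  rw [Nat.card_Ico] at hcard
  have h1 : (v - x) / d ≤ (⌈(v - x) / d⌉₊ : ℝ) := Nat.le_ceil _
  have h2 : (⌈(u - x) / d⌉₊ : ℝ) < (u - x) / d + 1 :=
    Nat.ceil_lt_add_one (div_nonneg (by linarith) hd.le)
  have h3 : (⌈(v - x) / d⌉₊ : ℝ) ≤
      (((Finset.range H).filter (fun h : ℕ => x + h * d ∈ Set.Ico u v)).card : ℝ)
        + (⌈(u - x) / d⌉₊ : ℝ) := by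
    exact_mod_cast Nat.sub_le_iff_le_add.1 hcard
  have h4 : (v - u) / d = (v - x) / d - (u - x) / d := by ring
  linarith

lemma fract_mem_Ico_of_near {α β ε y z : ℝ} {c : ℤ} (hα : 0 ≤ α) (hβ : β ≤ 1)
    (hyz : |y - z| ≤ ε) (hz : z ∈ Set.Ico (c + (α + ε)) (c + (β - ε))) :
    Int.fract y ∈ Set.Ico α β := by
  rw [abs_le] at hyz
  obtain ⟨h1, h2⟩ := hz
  have hf : ⌊y⌋ = c := by
    rw [Int.floor_eq_iff]
    constructor <;> linarith
  rw [← Int.self_sub_floor, hf]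
  constructor <;> linarith

lemma card_fract_window {α β ε d x : ℝ} {y : ℕ → ℝ} {H : ℕ} (hα : 0 ≤ α) (hβ : β ≤ 1)
    (hd : 0 < d) (hε : 0 < ε) (hH : 1 ≤ H * d)
    (hy : ∀ h < H, |y h - (x + h * d)| ≤ ε) :
    (β - α - 2 * ε) / d - 2 ≤
      (((Finset.range H).filter (fun h : ℕ => Int.fract (y h) ∈ Set.Ico α β)).card : ℝ) := by
  have hfl := Int.floor_add_fract x
  have hf0 := Int.fract_nonneg x
  have hf1 := Int.fract_lt_one x
  set c := ⌊x⌋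
  set f := Int.fract x
  have key : ∀ (e : ℤ) (u v : ℝ), α + ε ≤ u → v ≤ β - ε → x ≤ e + u → e + v ≤ x + H * d →
      (Finset.range H).filter (fun h : ℕ => x + h * d ∈ Set.Ico (e + u) (e + v)) ⊆
      (Finset.range H).filter (fun h : ℕ => Int.fract (y h) ∈ Set.Ico α β) := by
    intro e u v hu hv _ _ h hh
    rw [Finset.mem_filter, Finset.mem_range] at hh ⊢
    refine ⟨hh.1, fract_mem_Ico_of_near (c := e) hα hβ (hy h hh.1) ⟨?_, ?_⟩⟩
    · linarith [hh.2.1]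
    · linarith [hh.2.2]
  have single : ∀ (e : ℤ) (u v : ℝ), α + ε ≤ u → v ≤ β - ε → x ≤ e + u → e + v ≤ x + H * d →
      (v - u) / d - 1 ≤
      (((Finset.range H).filter (fun h : ℕ => Int.fract (y h) ∈ Set.Ico α β)).card : ℝ) := by
    intro e u v hu hv h1 h2
    have h3 := card_arith_progression_Ico hd h1 h2
    have h4 : ((e + v) - (e + u)) / d = (v - u) / d := by congr 1; ring
    rw [h4] at h3
    refine h3.trans ?_
    exact_mod_cast Finset.card_le_card (key e u v hu hv h1 h2)
  have hshape : (β - ε - (α + ε)) / d = (β - α - 2 * ε) / d := by congr 1; ring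
  rcases le_or_gt f (α + ε) with h1 | h1
  · have := single c (α + ε) (β - ε) le_rfl le_rfl (by linarith) (by linarith)
    linarith
  · rcases le_or_gt (β - ε) f with h2 | h2
    · have := single (c + 1) (α + ε) (β - ε) le_rfl le_rfl (by push_cast; linarith)
        (by push_cast; linarith)
      linarith
    · have a1 := card_arith_progression_Ico (x := x) (u := c + f) (v := c + (β - ε)) (H := H) hd
        (by linarith) (by linarith)
      have a2 := card_arith_progression_Ico (x := x) (u := (c + 1 : ℤ) + (α + ε))
        (v := (c + 1 : ℤ) + f) (H := H) hd
        (by push_cast; linarith) (by push_cast; linarith)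
      have s1 := key c f (β - ε) h1.le le_rfl (by linarith) (by linarith)
      have s2 := key (c + 1) (α + ε) f le_rfl h2.le (by push_cast; linarith)
        (by push_cast; linarith)
      have hdisj : Disjoint
          ((Finset.range H).filter (fun h : ℕ => x + h * d ∈ Set.Ico (c + f) (c + (β - ε))))
          ((Finset.range H).filter
            (fun h : ℕ => x + h * d ∈ Set.Ico ((c + 1 : ℤ) + (α + ε)) ((c + 1 : ℤ) + f))) := by
        rw [Finset.disjoint_filter]
        intro h _ hh1 hh2
        have := hh1.2
        have := hh2.1
        push_cast at this
        linarith
      have hc := Finset.card_le_card (Finset.union_subset s1 s2)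
      rw [Finset.card_union_of_disjoint hdisj] at hc
      have hc' : ((((Finset.range H).filter
          (fun h : ℕ => x + h * d ∈ Set.Ico (c + f) (c + (β - ε)))).card : ℝ) +
          (((Finset.range H).filter
            (fun h : ℕ => x + h * d ∈ Set.Ico ((c + 1 : ℤ) + (α + ε)) ((c + 1 : ℤ) + f))).card : ℝ))
          ≤ (((Finset.range H).filter (fun h : ℕ => Int.fract (y h) ∈ Set.Ico α β)).card : ℝ) := by
        exact_mod_cast hc
      have e1 : (c + (β - ε) - (c + f)) / d + (((c + 1 : ℤ) : ℝ) + f - ((c + 1 : ℤ) + (α + ε))) / d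
          = (β - α - 2 * ε) / d := by
        rw [← add_div]; congr 1; ring
      linarith

/-- If every `n ≥ N₀` starts a short window on which `f` grows at rate at least `ρ`, then `f` grows
globally at rate close to `ρ`. -/
lemma growth_of_windows {f : ℕ → ℝ} (hf : Monotone f) {ρ η : ℝ} (hρ : 0 ≤ ρ)
    {N₀ : ℕ} (h0 : 0 ≤ f N₀)
    (h : ∀ n ≥ N₀, ∃ H : ℕ, 1 ≤ H ∧ (H : ℝ) ≤ η * n ∧ ρ * H ≤ f (n + H) - f n)
    (hη : 0 ≤ η) {N : ℕ} (hN : N₀ ≤ N) : ρ * (N - N₀ - η * N) ≤ f N := by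
  classical
  set m := Nat.findGreatest (fun m => N₀ ≤ m ∧ ρ * (m - N₀ : ℝ) ≤ f m) N
  have hm : N₀ ≤ m ∧ ρ * (m - N₀ : ℝ) ≤ f m :=
    Nat.findGreatest_spec (P := fun m => N₀ ≤ m ∧ ρ * (m - N₀ : ℝ) ≤ f m) hN
      ⟨le_rfl, by simpa using h0⟩
  have hmN : m ≤ N := Nat.findGreatest_le N
  obtain ⟨H, h1, h2, h3⟩ := h m hm.1
  have hlt : N < m + H := by
    by_contra! hle
    refine Nat.findGreatest_is_greatest (P := fun m => N₀ ≤ m ∧ ρ * (m - N₀ : ℝ) ≤ f m)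
      (n := N) (k := m + H) (by change m < m + H; omega) hle ⟨by omega, ?_⟩
    push_cast
    linarith [hm.2]
  have hlt' : (N : ℝ) ≤ m + H := by exact_mod_cast hlt.le
  have hmN' : (m : ℝ) ≤ N := by exact_mod_cast hmN
  have : η * m ≤ η * N := by gcongr
  calc ρ * (N - N₀ - η * N) ≤ ρ * (m - N₀) := mul_le_mul_of_nonneg_left (by linarith) hρ
    _ ≤ f m := hm.2
    _ ≤ f N := hf hmN

open Filter Topology in
lemma eventually_card_fract_ge {x d : ℕ → ℝ} (hd : ∀ᶠ n in atTop, 0 < d n)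
    (hd0 : Tendsto d atTop (𝓝 0)) (hnd : Tendsto (fun n : ℕ => n * d n) atTop atTop)
    (hx : ∀ ε > 0, ∀ᶠ n in atTop, ∀ h : ℕ, (h : ℝ) ≤ 1 / d n + 1 →
      |x (n + h) - (x n + h * d n)| ≤ ε)
    {α β : ℝ} (hα : 0 ≤ α) (hβ : β ≤ 1) {η : ℝ} (hη : 0 < η) :
    ∀ᶠ N : ℕ in atTop, (β - α - η) * N ≤
      (((Finset.range N).filter (fun n => Int.fract (x n) ∈ Set.Ico α β)).card : ℝ) := by
  rcases le_or_gt (β - α - η / 2) 0 with hneg | hpos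
  · filter_upwards with N
    exact (mul_nonpos_of_nonpos_of_nonneg (by linarith) N.cast_nonneg).trans (Nat.cast_nonneg _)
  set f : ℕ → ℝ := fun N =>
    (((Finset.range N).filter (fun n => Int.fract (x n) ∈ Set.Ico α β)).card : ℝ) with hf
  set ρ := β - α - η / 2 with hρ
  have hfm : Monotone f := by
    intro a b hab
    simp only [hf]
    gcongr
  have hwin : ∀ᶠ n : ℕ in atTop, ∃ H : ℕ, 1 ≤ H ∧ (H : ℝ) ≤ (η / 4) * n ∧
      ρ * H ≤ f (n + H) - f n := by
    filter_upwards [hd, hd0.eventually (gt_mem_nhds (show (0 : ℝ) < min 1 (η / 12) by positivity)),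
      hnd.eventually_ge_atTop (8 / η), hx (η / 8) (by positivity)] with n hdn hdn0 hndn hxn
    have hd1 : d n < 1 := hdn0.trans_le (min_le_left _ _)
    have hd2 : d n < η / 12 := hdn0.trans_le (min_le_right _ _)
    have hc1 : (1 / d n : ℝ) ≤ ⌈1 / d n⌉₊ := Nat.le_ceil _
    have hc2 : (⌈1 / d n⌉₊ : ℝ) < 1 / d n + 1 := Nat.ceil_lt_add_one (by positivity)
    refine ⟨⌈1 / d n⌉₊, Nat.one_le_ceil_iff.2 (by positivity), ?_, ?_⟩
    · have h1 : 1 ≤ 1 / d n := by rw [le_div_iff₀ hdn]; linarith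
      have h2 : 2 * (1 / d n) ≤ η / 4 * n := by
        rw [mul_one_div, div_le_iff₀ hdn]
        rw [div_le_iff₀ hη] at hndn
        linarith
      linarith
    · have hw := card_fract_window (α := α) (β := β) (ε := η / 8) (d := d n) (x := x n)
        (y := fun h => x (n + h)) (H := ⌈1 / d n⌉₊) hα hβ hdn (by positivity)
        (by rwa [div_le_iff₀ hdn] at hc1)
        (fun h hh => hxn h (le_trans (by exact_mod_cast hh.le) hc2.le))
      have hsplit : f (n + ⌈1 / d n⌉₊) - f n = (((Finset.range ⌈1 / d n⌉₊).filter
          (fun h : ℕ => Int.fract (x (n + h)) ∈ Set.Ico α β)).card : ℝ) := by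
        simp only [hf, Finset.card_filter]
        rw [Finset.sum_range_add]
        push_cast
        ring
      rw [hsplit]
      refine le_trans ?_ hw
      have e1 : (β - α - 2 * (η / 8)) / d n = (ρ + η / 4) * (1 / d n) := by
        rw [hρ, mul_one_div]; congr 1; ring
      have e2 : 3 ≤ η / 4 * (1 / d n) := by
        rw [mul_one_div, le_div_iff₀ hdn]; linarith
      have e3 : ρ * ⌈1 / d n⌉₊ ≤ ρ * (1 / d n + 1) := by gcongr
      have e4 : ρ ≤ 1 := by rw [hρ]; linarith
      rw [e1]
      nlinarith
  obtain ⟨N₀, hN₀⟩ := eventually_atTop.1 hwin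
  have hlarge : ∀ᶠ N : ℕ in atTop, (4 * N₀ / η : ℝ) ≤ N :=
    tendsto_natCast_atTop_atTop.eventually_ge_atTop _
  filter_upwards [eventually_ge_atTop N₀, hlarge] with N hN hN2
  have := growth_of_windows hfm hpos.le (Nat.cast_nonneg _) hN₀ (by positivity) hN
  refine le_trans ?_ this
  rw [div_le_iff₀ hη] at hN2
  have e4 : ρ ≤ 1 := by rw [hρ]; linarith
  have e5 : (β - α - η) = ρ - η / 2 := by rw [hρ]; ring
  rw [e5]
  have hN0 : (0 : ℝ) ≤ N := N.cast_nonneg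
  have hN00 : (0 : ℝ) ≤ N₀ := N₀.cast_nonneg
  nlinarith [mul_nonneg (sub_nonneg.2 e4) hN00, mul_nonneg (sub_nonneg.2 e4) (mul_nonneg hη.le hN0)]

open Filter Topology in
/-- A sequence that is asymptotically linear with slope `d n → 0` on windows of length `1 / d n`,
where `n * d n → ∞`, is equidistributed modulo one. -/
theorem tendsto_card_fract_div {x d : ℕ → ℝ} (hd : ∀ᶠ n in atTop, 0 < d n)
    (hd0 : Tendsto d atTop (𝓝 0)) (hnd : Tendsto (fun n : ℕ => n * d n) atTop atTop)
    (hx : ∀ ε > 0, ∀ᶠ n in atTop, ∀ h : ℕ, (h : ℝ) ≤ 1 / d n + 1 →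
      |x (n + h) - (x n + h * d n)| ≤ ε)
    {α β : ℝ} (hα : 0 ≤ α) (hαβ : α < β) (hβ : β ≤ 1) :
    Tendsto (fun N : ℕ =>
      (Nat.card {n : ℕ | 1 ≤ n ∧ n ≤ N ∧ Int.fract (x n) ∈ Set.Ico α β} : ℝ) / (N : ℝ))
      atTop (𝓝 (β - α)) := by
  set F : ℝ → ℝ → ℕ → ℕ := fun a b N =>
    ((Finset.range N).filter (fun n => Int.fract (x n) ∈ Set.Ico a b)).card with hF
  have hlow : ∀ a b : ℝ, 0 ≤ a → b ≤ 1 → ∀ η > 0, ∀ᶠ N : ℕ in atTop, (b - a - η) * N ≤ F a b N :=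
    fun a b ha hb η hη => eventually_card_fract_ge hd hd0 hnd hx ha hb hη
  have hpart : ∀ N, F 0 α N + F α β N + F β 1 N = N := by
    intro N
    simp only [hF, Finset.card_filter]
    rw [← Finset.sum_add_distrib, ← Finset.sum_add_distrib]
    conv_rhs => rw [← Finset.card_range N, Finset.card_eq_sum_ones]
    refine Finset.sum_congr rfl fun n _ => ?_
    have h0 := Int.fract_nonneg (x n)
    have h1 := Int.fract_lt_one (x n)
    simp only [Set.mem_Ico]
    rcases lt_or_ge (Int.fract (x n)) α with h | h
    · simp [h, h0, not_le.2 h, not_le.2 (h.trans hαβ)]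
    · rcases lt_or_ge (Int.fract (x n)) β with h' | h'
      · simp [h, h', not_lt.2 h, not_le.2 h']
      · simp [h, h', not_lt.2 h, not_lt.2 h', h1]
  have hcount : ∀ N : ℕ, Nat.card {n : ℕ | 1 ≤ n ∧ n ≤ N ∧ Int.fract (x n) ∈ Set.Ico α β} =
      ((Finset.Icc 1 N).filter (fun n => Int.fract (x n) ∈ Set.Ico α β)).card := by
    intro N
    rw [Nat.card_coe_set_eq, ← Set.ncard_coe_finset]
    congr 1
    ext n
    simp [and_assoc]
  have hcle : ∀ N : ℕ, ((Finset.Icc 1 N).filter (fun n => Int.fract (x n) ∈ Set.Ico α β)).card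
      ≤ F α β N + 1 := by
    intro N
    have hsub : (Finset.Icc 1 N).filter (fun n => Int.fract (x n) ∈ Set.Ico α β) ⊆
        insert N ((Finset.range N).filter (fun n => Int.fract (x n) ∈ Set.Ico α β)) := by
      intro n hn
      simp only [Finset.mem_filter, Finset.mem_Icc, Finset.mem_insert, Finset.mem_range] at hn ⊢
      rcases hn.1.2.lt_or_eq with h | h
      · exact Or.inr ⟨h, hn.2⟩
      · exact Or.inl h
    exact (Finset.card_le_card hsub).trans (Finset.card_insert_le _ _)
  have hcge : ∀ N : ℕ, F α β N ≤
      ((Finset.Icc 1 N).filter (fun n => Int.fract (x n) ∈ Set.Ico α β)).card + 1 := by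
    intro N
    have hsub : (Finset.range N).filter (fun n => Int.fract (x n) ∈ Set.Ico α β) ⊆
        insert 0 ((Finset.Icc 1 N).filter (fun n => Int.fract (x n) ∈ Set.Ico α β)) := by
      intro n hn
      simp only [Finset.mem_filter, Finset.mem_Icc, Finset.mem_insert, Finset.mem_range] at hn ⊢
      rcases Nat.eq_zero_or_pos n with h | h
      · exact Or.inl h
      · exact Or.inr ⟨⟨h, hn.1.le⟩, hn.2⟩
    exact (Finset.card_le_card hsub).trans (Finset.card_insert_le _ _)
  rw [Metric.tendsto_nhds]
  intro ε hε
  have hlarge : ∀ᶠ N : ℕ in atTop, (8 / ε : ℝ) ≤ N :=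
    tendsto_natCast_atTop_atTop.eventually_ge_atTop _
  filter_upwards [hlow 0 α le_rfl (hαβ.le.trans hβ) (ε / 4) (by positivity),
    hlow α β hα hβ (ε / 4) (by positivity),
    hlow β 1 (hα.trans hαβ.le) le_rfl (ε / 4) (by positivity), hlarge,
    eventually_gt_atTop 0] with N h1 h2 h3 h4 h5
  have h5' : (0 : ℝ) < N := by exact_mod_cast h5
  rw [hcount, Real.dist_eq, abs_lt]
  have c1 : (((Finset.Icc 1 N).filter (fun n => Int.fract (x n) ∈ Set.Ico α β)).card : ℝ)
      ≤ F α β N + 1 := by exact_mod_cast hcle N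
  have c2 : (F α β N : ℝ) ≤
      ((Finset.Icc 1 N).filter (fun n => Int.fract (x n) ∈ Set.Ico α β)).card + 1 := by
    exact_mod_cast hcge N
  have c3 : (F 0 α N : ℝ) + F α β N + F β 1 N = N := by exact_mod_cast hpart N
  rw [div_le_iff₀ hε] at h4
  constructor
  · rw [lt_sub_iff_add_lt, lt_div_iff₀ h5']
    nlinarith
  · rw [sub_lt_iff_lt_add, div_lt_iff₀ h5']
    nlinarith

/-- The total weight of a multiset of parts. -/
def totalWeight {ι : Type*} (w : ι → ℕ) (M : Multiset ι) : ℕ := (M.map w).sum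

@[simp] lemma totalWeight_add {ι : Type*} (w : ι → ℕ) (M N : Multiset ι) :
    totalWeight w (M + N) = totalWeight w M + totalWeight w N := by
  simp [totalWeight]

@[simp] lemma totalWeight_replicate {ι : Type*} (w : ι → ℕ) (n : ℕ) (a : ι) :
    totalWeight w (Multiset.replicate n a) = n * w a := by
  simp [totalWeight]

lemma weight_le_totalWeight {ι : Type*} (w : ι → ℕ) {M : Multiset ι} {a : ι} (ha : a ∈ M) :
    w a ≤ totalWeight w M :=
  Multiset.single_le_sum (fun _ _ => Nat.zero_le _) _ (Multiset.mem_map_of_mem w ha)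

/-- Multisets of parts from `S` of total weight `k`. -/
def partSet {ι : Type*} (w : ι → ℕ) (S : Finset ι) (k : ℕ) : Set (Multiset ι) :=
  {M | (∀ b ∈ M, b ∈ S) ∧ totalWeight w M = k}

/-- Splitting off the copies of a part `a` from a multiset of parts. -/
def splitPartEquiv {ι : Type*} [DecidableEq ι] {S : Finset ι} {a : ι} (ha : a ∉ S) :
    ℕ × {M : Multiset ι // ∀ b ∈ M, b ∈ S} ≃ {M : Multiset ι // ∀ b ∈ M, b ∈ insert a S} where
  toFun p := ⟨Multiset.replicate p.1 a + p.2.1, by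
    intro b hb
    rcases Multiset.mem_add.1 hb with h | h
    · exact Finset.mem_insert.2 (Or.inl (Multiset.eq_of_mem_replicate h))
    · exact Finset.mem_insert_of_mem (p.2.2 b h)⟩
  invFun M := (M.1.count a, ⟨M.1.filter (· ≠ a), by
    intro b hb
    rw [Multiset.mem_filter] at hb
    exact Finset.mem_of_mem_insert_of_ne (M.2 b hb.1) hb.2⟩)
  left_inv := by
    rintro ⟨j, M, hM⟩
    have haM : a ∉ M := fun h => ha (hM a h)
    have h1 : M.filter (· ≠ a) = M :=
      Multiset.filter_eq_self.2 fun b hb hba => haM (hba ▸ hb)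
    simp only [Multiset.count_add, Multiset.count_replicate_self,
      Multiset.count_eq_zero_of_notMem haM, add_zero, Multiset.filter_add, h1, Prod.mk.injEq,
      true_and, Subtype.mk.injEq]
    rw [Multiset.filter_eq_nil.2, zero_add]
    intro b hb
    simpa using Multiset.eq_of_mem_replicate hb
  right_inv := by
    rintro ⟨M, hM⟩
    simp only [Subtype.mk.injEq]
    rw [← Multiset.filter_eq' M a]
    exact Multiset.filter_add_not _ M

lemma hasSum_pow_totalWeight {ι : Type*} [DecidableEq ι] {𝕜 : Type*} [NormedField 𝕜]
    [CompleteSpace 𝕜] (w : ι → ℕ) (S : Finset ι) (hS : ∀ b ∈ S, 0 < w b) {z : 𝕜} (hz : ‖z‖ < 1) :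
    HasSum (fun M : {M : Multiset ι // ∀ b ∈ M, b ∈ S} => z ^ totalWeight w M.1)
      (∏ b ∈ S, (1 - z ^ w b)⁻¹) ∧
    Summable (fun M : {M : Multiset ι // ∀ b ∈ M, b ∈ S} => ‖z ^ totalWeight w M.1‖) := by
  induction S using Finset.induction_on with
  | empty =>
    have hu : ∀ M : {M : Multiset ι // ∀ b ∈ M, b ∈ (∅ : Finset ι)}, M = ⟨0, by simp⟩ := by
      rintro ⟨M, hM⟩
      exact Subtype.ext (Multiset.eq_zero_of_forall_notMem fun b hb => by simpa using hM b hb)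
    let _ : Unique {M : Multiset ι // ∀ b ∈ M, b ∈ (∅ : Finset ι)} := ⟨⟨⟨0, by simp⟩⟩, hu⟩
    constructor
    · have h := hasSum_unique (fun M : {M : Multiset ι // ∀ b ∈ M, b ∈ (∅ : Finset ι)} =>
        z ^ totalWeight w M.1)
      rw [hu default] at h
      simpa [totalWeight] using h
    · exact (hasSum_unique _).summable
  | insert a S ha ih =>
    obtain ⟨ih1, ih2⟩ := ih fun b hb => hS b (Finset.mem_insert_of_mem hb)
    have hza : ‖z ^ w a‖ < 1 := by
      rw [norm_pow]
      exact pow_lt_one₀ (norm_nonneg _) hz (hS a (Finset.mem_insert_self _ _)).ne'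
    have hg := hasSum_geometric_of_norm_lt_one hza
    have hgn : Summable fun n : ℕ => ‖(z ^ w a) ^ n‖ :=
      summable_norm_geometric_of_norm_lt_one hza
    have hpt : ∀ p : ℕ × {M : Multiset ι // ∀ b ∈ M, b ∈ S},
        z ^ totalWeight w (splitPartEquiv ha p).1 = (z ^ w a) ^ p.1 * z ^ totalWeight w p.2.1 := by
      intro p
      simp [splitPartEquiv, pow_add, ← pow_mul, mul_comm]
    have hfun : (fun M : {M : Multiset ι // ∀ b ∈ M, b ∈ insert a S} => z ^ totalWeight w M.1) ∘
        splitPartEquiv ha = fun p => (z ^ w a) ^ p.1 * z ^ totalWeight w p.2.1 := funext hpt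
    have hfun' : (fun M : {M : Multiset ι // ∀ b ∈ M, b ∈ insert a S} =>
        ‖z ^ totalWeight w M.1‖) ∘ splitPartEquiv ha =
        fun p => ‖(z ^ w a) ^ p.1 * z ^ totalWeight w p.2.1‖ :=
      funext fun p => congrArg norm (hpt p)
    have hPn := Summable.mul_norm (f := fun n : ℕ => (z ^ w a) ^ n)
      (g := fun M : {M : Multiset ι // ∀ b ∈ M, b ∈ S} => z ^ totalWeight w M.1) hgn ih2
    have hP := hg.mul ih1 hPn.of_norm
    rw [Finset.prod_insert ha, ← (splitPartEquiv ha).hasSum_iff, ← (splitPartEquiv ha).summable_iff,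
      hfun, hfun']
    exact ⟨hP, hPn⟩

lemma partSet_finite {ι : Type*} (w : ι → ℕ) (S : Finset ι) (hS : ∀ b ∈ S, 0 < w b) (k : ℕ) :
    (partSet w S k).Finite := by
  classical
  have h := (hasSum_pow_totalWeight w S hS (z := (1 / 2 : ℝ)) (by norm_num)).2
  by_contra hinf
  have hinf' : Infinite (partSet w S k) := Set.infinite_coe_iff.2 hinf
  let e : partSet w S k → {M : Multiset ι // ∀ b ∈ M, b ∈ S} := fun M => ⟨M.1, M.2.1⟩
  have he : Function.Injective e := fun M N hMN => Subtype.ext (congrArg (fun x => x.1) hMN)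
  have h2 := h.comp_injective he
  have h3 : ((fun M : {M : Multiset ι // ∀ b ∈ M, b ∈ S} =>
      ‖(1 / 2 : ℝ) ^ totalWeight w M.1‖) ∘ e) = fun _ => ‖(1 / 2 : ℝ) ^ k‖ := by
    funext M
    simp only [Function.comp, e, M.2.2]
  rw [h3, summable_const_iff] at h2
  norm_num at h2

lemma hasSum_partSet_indicator {ι 𝕜 : Type*} [NormedField 𝕜] (w : ι → ℕ) (S : Finset ι)
    (hS : ∀ b ∈ S, 0 < w b) (k : ℕ) (c : 𝕜) :
    HasSum (fun M : {M : Multiset ι // ∀ b ∈ M, b ∈ S} => if totalWeight w M.1 = k then c else 0)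
      ((partSet w S k).ncard * c) := by
  classical
  have hfin := partSet_finite w S hS k
  let e : partSet w S k → {M : Multiset ι // ∀ b ∈ M, b ∈ S} := fun M => ⟨M.1, M.2.1⟩
  have he : Function.Injective e := fun M N hMN => Subtype.ext (congrArg (fun x => x.1) hMN)
  have := hfin.fintype
  rw [← he.hasSum_iff]
  · have h3 : ((fun M : {M : Multiset ι // ∀ b ∈ M, b ∈ S} =>
        if totalWeight w M.1 = k then c else 0) ∘ e) = fun _ => c := by
      funext M
      simp only [Function.comp, e, M.2.2, if_true]
    rw [h3]
    convert hasSum_fintype (fun _ : partSet w S k => c) using 1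
    rw [Finset.sum_const, nsmul_eq_mul, Finset.card_univ, ← Nat.card_eq_fintype_card,
      Nat.card_coe_set_eq]
  · intro M hM
    rw [if_neg]
    exact fun h => hM ⟨⟨M.1, M.2, h⟩, rfl⟩

lemma ncard_partSet_mul_pow_le {ι : Type*} [DecidableEq ι] (w : ι → ℕ) (S : Finset ι)
    (hS : ∀ b ∈ S, 0 < w b) (k : ℕ) {r : ℝ} (hr0 : 0 < r) (hr1 : r < 1) :
    (partSet w S k).ncard * r ^ k ≤ ∏ b ∈ S, (1 - r ^ w b)⁻¹ := by
  refine hasSum_le (fun M => ?_) (hasSum_partSet_indicator w S hS k (r ^ k))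
    (hasSum_pow_totalWeight w S hS (z := r) (by rwa [Real.norm_of_nonneg hr0.le])).1
  split_ifs with h
  · rw [h]
  · positivity

open Complex in
lemma integral_exp_int_mul_I (m k : ℕ) :
    ∫ θ in (-Real.pi)..Real.pi, exp (((m : ℂ) - k) * I * θ) =
      if m = k then (2 * Real.pi : ℂ) else 0 := by
  split_ifs with h
  · subst h
    simp
    ring
  · have hc : ((m : ℂ) - k) * I ≠ 0 := by
      refine mul_ne_zero (sub_ne_zero.2 ?_) I_ne_zero
      exact_mod_cast h
    rw [integral_exp_mul_complex hc]
    have : exp (((m : ℂ) - k) * I * (Real.pi : ℝ)) = exp (((m : ℂ) - k) * I * ((-Real.pi : ℝ) : ℂ)) := by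
      rw [Complex.exp_eq_exp_iff_exists_int]
      refine ⟨(m : ℤ) - k, ?_⟩
      push_cast
      ring
    rw [this, sub_self, zero_div]

open Complex in
/-- The number of partitions of `k` into parts from `S` as a Fourier coefficient. -/
lemma integral_prod_inv_mul_exp {ι : Type*} [DecidableEq ι] [Countable ι] (w : ι → ℕ) (S : Finset ι)
    (hS : ∀ b ∈ S, 0 < w b) (k : ℕ) {r : ℝ} (hr0 : 0 < r) (hr1 : r < 1) :
    ∫ θ in (-Real.pi)..Real.pi,
      (∏ b ∈ S, (1 - ((r : ℂ) * exp (θ * I)) ^ w b)⁻¹) * exp (-(k * θ * I)) =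
      2 * Real.pi * ((partSet w S k).ncard * (r : ℂ) ^ k) := by
  have hnorm : ∀ θ : ℝ, ‖(r : ℂ) * exp (θ * I)‖ = r := by
    intro θ
    rw [norm_mul, norm_exp_ofReal_mul_I, mul_one, norm_real, Real.norm_of_nonneg hr0.le]
  have hsumm := (hasSum_pow_totalWeight w S hS (z := r) (by rwa [Real.norm_of_nonneg hr0.le])).1
  have H := intervalIntegral.hasSum_integral_of_dominated_convergence
    (μ := MeasureTheory.volume) (a := -Real.pi) (b := Real.pi)
    (F := fun (M : {M : Multiset ι // ∀ b ∈ M, b ∈ S}) (θ : ℝ) =>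
      ((r : ℂ) * exp (θ * I)) ^ totalWeight w M.1 * exp (-(k * θ * I)))
    (f := fun θ : ℝ => (∏ b ∈ S, (1 - ((r : ℂ) * exp (θ * I)) ^ w b)⁻¹) * exp (-(k * θ * I)))
    (fun M _ => r ^ totalWeight w M.1)
    (fun M => (by fun_prop : Continuous fun θ : ℝ =>
      ((r : ℂ) * exp (θ * I)) ^ totalWeight w M.1 * exp (-(k * θ * I))).aestronglyMeasurable)
    (fun M => Filter.Eventually.of_forall fun θ _ => by
      rw [norm_mul, norm_pow, hnorm]
      have : ‖exp (-(k * θ * I))‖ = 1 := by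
        rw [show -((k : ℂ) * θ * I) = ((-(k * θ) : ℝ) : ℂ) * I by push_cast; ring]
        exact norm_exp_ofReal_mul_I _
      rw [this, mul_one])
    (Filter.Eventually.of_forall fun θ _ => hsumm.summable)
    intervalIntegrable_const
    (Filter.Eventually.of_forall fun θ _ =>
      ((hasSum_pow_totalWeight w S hS (z := (r : ℂ) * exp (θ * I))
        (by rwa [hnorm])).1).mul_right _)
  refine H.unique ?_
  have hterm : ∀ M : {M : Multiset ι // ∀ b ∈ M, b ∈ S},
      ∫ θ in (-Real.pi)..Real.pi,
        ((r : ℂ) * exp (θ * I)) ^ totalWeight w M.1 * exp (-(k * θ * I)) =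
      if totalWeight w M.1 = k then (2 * Real.pi * (r : ℂ) ^ k) else 0 := by
    intro M
    have h1 : ∀ θ : ℝ, ((r : ℂ) * exp (θ * I)) ^ totalWeight w M.1 * exp (-(k * θ * I)) =
        (r : ℂ) ^ totalWeight w M.1 * exp (((totalWeight w M.1 : ℕ) - (k : ℂ)) * I * θ) := by
      intro θ
      rw [mul_pow, mul_assoc, ← Complex.exp_nat_mul, ← Complex.exp_add]
      congr 2
      ring
    simp_rw [h1]
    rw [intervalIntegral.integral_const_mul, integral_exp_int_mul_I]
    split_ifs with h
    · rw [h]; ring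
    · simp
  simp_rw [hterm]
  rw [mul_left_comm]
  exact hasSum_partSet_indicator w S hS k (2 * Real.pi * (r : ℂ) ^ k)

open Complex in
lemma norm_exp_mul_I_taylor_two (x : ℝ) :
    ‖exp (x * I) - 1 - x * I + x ^ 2 / 2‖ ≤ 4 * |x| ^ 3 := by
  have hn : ‖(x : ℂ) * I‖ = |x| := by simp
  rcases le_or_gt |x| 1 with h | h
  · have h1 := Complex.exp_bound (x := (x : ℂ) * I) (by rwa [hn]) (n := 3) (by norm_num)
    have h2 : exp (x * I) - 1 - x * I + x ^ 2 / 2 =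
        exp (x * I) - ∑ m ∈ Finset.range 3, ((x : ℂ) * I) ^ m / (m.factorial : ℂ) := by
      simp [Finset.sum_range_succ, Nat.factorial, mul_pow]
      ring
    rw [h2]
    refine h1.trans ?_
    rw [hn]
    norm_num [Nat.factorial]
    nlinarith [pow_nonneg (abs_nonneg x) 3]
  · have h1 : ‖exp (x * I)‖ = 1 := norm_exp_ofReal_mul_I x
    have h3 : ‖(x : ℂ) ^ 2 / 2‖ = |x| ^ 2 / 2 := by simp
    have h4 : ‖exp (x * I) - 1 - x * I + x ^ 2 / 2‖ ≤ 1 + 1 + |x| + |x| ^ 2 / 2 := by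
      refine (norm_add_le _ _).trans (add_le_add ?_ h3.le)
      refine (norm_sub_le _ _).trans (add_le_add ?_ hn.le)
      refine (norm_sub_le _ _).trans (add_le_add h1.le ?_)
      simp
    refine h4.trans ?_
    have h5 : |x| ≤ |x| ^ 3 := le_self_pow₀ h.le (by norm_num)
    have h6 : |x| ^ 2 ≤ |x| ^ 3 := pow_le_pow_right₀ h.le (by norm_num)
    linarith

lemma hasSum_pow_succ {q : ℝ} (hq0 : 0 < q) (hq1 : q < 1) :
    HasSum (fun n : ℕ => q ^ (n + 1)) (q / (1 - q)) := by
  simpa only [pow_succ', div_eq_mul_inv] using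
    (hasSum_geometric_of_lt_one hq0.le hq1).mul_left q

lemma hasSum_succ_mul_pow_succ {q : ℝ} (hq0 : 0 < q) (hq1 : q < 1) :
    HasSum (fun n : ℕ => ((n : ℝ) + 1) * q ^ (n + 1)) (q / (1 - q) ^ 2) := by
  have h := (hasSum_choose_mul_geometric_of_norm_lt_one 1
    (show ‖q‖ < 1 by rwa [Real.norm_of_nonneg hq0.le])).mul_left q
  rw [← div_eq_mul_one_div] at h
  refine HasSum.congr_fun h fun n => ?_
  rw [Nat.choose_one_right]
  push_cast
  ring

lemma hasSum_choose_mul_pow_succ {q : ℝ} (hq0 : 0 < q) (hq1 : q < 1) :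
    HasSum (fun n : ℕ => ((n : ℝ) + 2) * (n + 1) / 2 * q ^ (n + 1)) (q / (1 - q) ^ 3) := by
  have h := (hasSum_choose_mul_geometric_of_norm_lt_one 2
    (show ‖q‖ < 1 by rwa [Real.norm_of_nonneg hq0.le])).mul_left q
  rw [← div_eq_mul_one_div] at h
  refine HasSum.congr_fun h fun n => ?_
  rw [Nat.cast_choose_two]
  push_cast
  ring

lemma norm_ofReal_mul_exp_mul_I {q : ℝ} (hq0 : 0 < q) (y : ℝ) :
    ‖(q : ℂ) * Complex.exp (y * Complex.I)‖ = q := by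
  rw [norm_mul, Complex.norm_exp_ofReal_mul_I, mul_one, Complex.norm_real,
    Real.norm_of_nonneg hq0.le]

lemma one_sub_ofReal_mul_exp_ne_zero {q : ℝ} (hq0 : 0 < q) (hq1 : q < 1) (y : ℝ) :
    1 - (q : ℂ) * Complex.exp (y * Complex.I) ≠ 0 := by
  intro h
  have h1 := norm_ofReal_mul_exp_mul_I hq0 y
  rw [← sub_eq_zero.1 h, norm_one] at h1
  linarith

open Complex in
/-- Second order expansion of the characteristic function of a geometric random variable. -/
lemma geometric_charFun_eq_exp {q : ℝ} (hq0 : 0 < q) (hq1 : q < 1) (y : ℝ) :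
    ∃ e : ℂ, ‖e‖ ≤ 8 * |y| ^ 3 * (q / (1 - q) ^ 3) ∧
      (1 - (q : ℂ)) / (1 - q * exp (y * I)) =
        exp (((q / (1 - q) : ℝ) : ℂ) * y * I - ((q / (1 - q) ^ 2 : ℝ) : ℂ) * y ^ 2 / 2 + e) := by
  have hz := norm_ofReal_mul_exp_mul_I hq0 y
  have hz1 : ‖(q : ℂ) * exp (y * I)‖ < 1 := by rwa [hz]
  have hne := one_sub_ofReal_mul_exp_ne_zero hq0 hq1 y
  have hq1' : (1 : ℂ) - q ≠ 0 := by
    rw [sub_ne_zero]; exact_mod_cast hq1.ne'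
  set e : ℂ := -log (1 - q * exp (y * I)) - -log (1 - (q : ℂ)) -
    ((q / (1 - q) : ℝ) : ℂ) * y * I + ((q / (1 - q) ^ 2 : ℝ) : ℂ) * y ^ 2 / 2 with he
  refine ⟨e, ?_, ?_⟩
  · have s1 := hasSum_taylorSeries_neg_log' hz1
    have s2 := hasSum_taylorSeries_neg_log' (z := (q : ℂ))
      (by rwa [norm_real, Real.norm_of_nonneg hq0.le])
    have s3 := ((hasSum_ofReal.2 (hasSum_pow_succ hq0 hq1)).mul_right (y : ℂ)).mul_right I
    have s4 := ((hasSum_ofReal.2 (hasSum_succ_mul_pow_succ hq0 hq1)).mul_right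
      ((y : ℂ) ^ 2)).div_const 2
    have s5 := ((s1.sub s2).sub s3).add s4
    have b := (hasSum_choose_mul_pow_succ hq0 hq1).mul_left (8 * |y| ^ 3)
    rw [he, ← s5.tsum_eq, ← b.tsum_eq]
    refine (tsum_of_norm_bounded b.summable.hasSum fun n => ?_)
    have hn0 : ((n : ℂ) + 1) ≠ 0 := by exact_mod_cast n.succ_ne_zero
    have hterm : ((q : ℂ) * exp (y * I)) ^ (n + 1) / (n + 1) - (q : ℂ) ^ (n + 1) / (n + 1) -
        ((q ^ (n + 1) : ℝ) : ℂ) * y * I + ((((n : ℝ) + 1) * q ^ (n + 1) : ℝ) : ℂ) * (y : ℂ) ^ 2 / 2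
        = ((q ^ (n + 1) / (n + 1) : ℝ) : ℂ) *
          (exp ((((n + 1) * y : ℝ) : ℂ) * I) - 1 - (((n + 1) * y : ℝ) : ℂ) * I +
            (((n + 1) * y : ℝ) : ℂ) ^ 2 / 2) := by
      rw [mul_pow, ← Complex.exp_nat_mul]
      have : (((n + 1 : ℕ) : ℂ) * (y * I)) = ((((n + 1) * y : ℝ) : ℂ) * I) := by
        push_cast; ring
      rw [this]
      push_cast
      field_simp
    rw [hterm, norm_mul, norm_real, Real.norm_of_nonneg (by positivity)]
    calc q ^ (n + 1) / (n + 1) * _ ≤ q ^ (n + 1) / (n + 1) * (4 * |(n + 1) * y| ^ 3) := by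
          gcongr
          exact norm_exp_mul_I_taylor_two _
      _ = 4 * |y| ^ 3 * ((n + 1) ^ 2 * q ^ (n + 1)) := by
          rw [abs_mul, abs_of_nonneg (by positivity : (0 : ℝ) ≤ n + 1)]
          field_simp
      _ ≤ 4 * |y| ^ 3 * (2 * (((n : ℝ) + 2) * (n + 1) / 2) * q ^ (n + 1)) := by
          gcongr
          nlinarith [(Nat.cast_nonneg n : (0 : ℝ) ≤ n)]
      _ = _ := by ring
  · rw [he]
    have : ((q / (1 - q) : ℝ) : ℂ) * y * I - ((q / (1 - q) ^ 2 : ℝ) : ℂ) * y ^ 2 / 2 +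
        (-log (1 - q * exp (y * I)) - -log (1 - (q : ℂ)) -
    ((q / (1 - q) : ℝ) : ℂ) * y * I + ((q / (1 - q) ^ 2 : ℝ) : ℂ) * y ^ 2 / 2) =
        log (1 - (q : ℂ)) - log (1 - q * exp (y * I)) := by ring
    rw [this, Complex.exp_sub, exp_log hq1', exp_log hne]

open Complex in
lemma norm_geometric_charFun_le {q : ℝ} (hq0 : 0 < q) (hq1 : q < 1) (y : ℝ) :
    ‖(1 - (q : ℂ)) / (1 - q * exp (y * I))‖ ≤ Real.exp (-(q * (1 - Real.cos y))) := by
  have hz := norm_ofReal_mul_exp_mul_I hq0 y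
  have hz1 : ‖(q : ℂ) * exp (y * I)‖ < 1 := by rwa [hz]
  have hne := one_sub_ofReal_mul_exp_ne_zero hq0 hq1 y
  have hq1' : (1 : ℂ) - q ≠ 0 := by
    rw [sub_ne_zero]; exact_mod_cast hq1.ne'
  have s1 := hasSum_taylorSeries_neg_log' hz1
  have s2 := hasSum_taylorSeries_neg_log' (z := (q : ℂ))
      (by rwa [norm_real, Real.norm_of_nonneg hq0.le])
  have s3 := hasSum_re (s2.sub s1)
  have hterm : ∀ n : ℕ, ((q : ℂ) ^ (n + 1) / (n + 1) -
      ((q : ℂ) * exp (y * I)) ^ (n + 1) / (n + 1)).re =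
      q ^ (n + 1) / (n + 1) * (1 - Real.cos ((n + 1) * y)) := by
    intro n
    have hn0 : ((n : ℂ) + 1) ≠ 0 := by exact_mod_cast n.succ_ne_zero
    have : ((q : ℂ) ^ (n + 1) / (n + 1) - ((q : ℂ) * exp (y * I)) ^ (n + 1) / (n + 1)) =
        ((q ^ (n + 1) / (n + 1) : ℝ) : ℂ) * (1 - exp ((((n + 1) * y : ℝ) : ℂ) * I)) := by
      rw [mul_pow, ← Complex.exp_nat_mul]
      have : (((n + 1 : ℕ) : ℂ) * (y * I)) = ((((n + 1) * y : ℝ) : ℂ) * I) := by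
        push_cast; ring
      rw [this]
      push_cast
      ring
    rw [this, re_ofReal_mul, sub_re, one_re, exp_ofReal_mul_I_re]
  have h0 : q * (1 - Real.cos y) ≤ (-log (1 - (q : ℂ)) - -log (1 - q * exp (y * I))).re := by
    have := le_hasSum s3 0 (fun n _ => by
      rw [hterm]
      exact mul_nonneg (by positivity) (sub_nonneg.2 (Real.cos_le_one _)))
    rw [hterm] at this
    simpa using this
  have h1 : (1 - (q : ℂ)) / (1 - q * exp (y * I)) =
      exp (-(-log (1 - (q : ℂ)) - -log (1 - q * exp (y * I)))) := by
    rw [show -(-log (1 - (q : ℂ)) - -log (1 - q * exp (y * I))) =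
      log (1 - (q : ℂ)) - log (1 - q * exp (y * I)) by ring, Complex.exp_sub, exp_log hq1',
      exp_log hne]
  rw [h1, norm_exp, neg_re]
  exact Real.exp_le_exp.2 (neg_le_neg h0)

/-- The characteristic function at `θ` of the total weight of a random multiset of parts from `S`
under the Boltzmann distribution with parameter `exp (-t)`. -/
noncomputable def boltzmannCharFun {ι : Type*} (w : ι → ℕ) (S : Finset ι) (t θ : ℝ) : ℂ :=
  ∏ b ∈ S, (1 - (Real.exp (-(t * w b)) : ℂ)) /
    (1 - Real.exp (-(t * w b)) * Complex.exp ((w b * θ : ℝ) * Complex.I))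

/-- The sums controlling the mean (`p = 1`), the variance (`p = 2`) and the third order error
(`p = 3`) of the Boltzmann distribution. -/
noncomputable def boltzmannMoment {ι : Type*} (w : ι → ℕ) (S : Finset ι) (p : ℕ) (t : ℝ) : ℝ :=
  ∑ b ∈ S, (w b : ℝ) ^ p * (Real.exp (-(t * w b)) / (1 - Real.exp (-(t * w b))) ^ p)

lemma exp_neg_mul_lt_one {t : ℝ} (ht : 0 < t) {m : ℕ} (hm : 0 < m) :
    Real.exp (-(t * m)) < 1 := by
  rw [Real.exp_lt_one_iff]
  have : (0 : ℝ) < m := by exact_mod_cast hm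
  nlinarith

open Complex in
lemma boltzmannCharFun_eq_exp {ι : Type*} (w : ι → ℕ) (S : Finset ι) (hS : ∀ b ∈ S, 0 < w b)
    {t : ℝ} (ht : 0 < t) (θ : ℝ) :
    ∃ e : ℂ, ‖e‖ ≤ 8 * |θ| ^ 3 * boltzmannMoment w S 3 t ∧
      boltzmannCharFun w S t θ =
        exp ((boltzmannMoment w S 1 t : ℂ) * θ * I -
          (boltzmannMoment w S 2 t : ℂ) * θ ^ 2 / 2 + e) := by
  have h : ∀ b : S, ∃ e : ℂ, ‖e‖ ≤ 8 * |(w b : ℝ) * θ| ^ 3 *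
      (Real.exp (-(t * w b)) / (1 - Real.exp (-(t * w b))) ^ 3) ∧
      (1 - (Real.exp (-(t * w b)) : ℂ)) /
        (1 - Real.exp (-(t * w b)) * exp ((w b * θ : ℝ) * I)) =
        exp (((Real.exp (-(t * w b)) / (1 - Real.exp (-(t * w b))) : ℝ) : ℂ) *
          ((w b * θ : ℝ) : ℂ) * I - ((Real.exp (-(t * w b)) / (1 - Real.exp (-(t * w b))) ^ 2 : ℝ) : ℂ) *
          ((w b * θ : ℝ) : ℂ) ^ 2 / 2 + e) := fun b =>
    geometric_charFun_eq_exp (Real.exp_pos _) (exp_neg_mul_lt_one ht (hS b b.2)) _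
  choose e he1 he2 using h
  refine ⟨∑ b, e b, ?_, ?_⟩
  · refine (norm_sum_le _ _).trans ?_
    rw [boltzmannMoment, Finset.mul_sum, ← Finset.sum_coe_sort S]
    refine Finset.sum_le_sum fun b _ => (he1 b).trans (le_of_eq ?_)
    rw [abs_mul, Nat.abs_cast]
    ring
  · rw [boltzmannCharFun, ← Finset.prod_coe_sort S, Finset.prod_congr rfl fun b _ => he2 b,
      ← Complex.exp_sum]
    congr 1
    rw [Finset.sum_add_distrib, Finset.sum_sub_distrib, boltzmannMoment, boltzmannMoment,
      ← Finset.sum_coe_sort S, ← Finset.sum_coe_sort S]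
    push_cast
    simp only [Finset.sum_mul, Finset.sum_div]
    congr 2 <;> refine Finset.sum_congr rfl fun b _ => ?_
    · ring
    · ring

lemma norm_boltzmannCharFun_le {ι : Type*} (w : ι → ℕ) (S : Finset ι) (hS : ∀ b ∈ S, 0 < w b)
    {t : ℝ} (ht : 0 < t) (θ : ℝ) :
    ‖boltzmannCharFun w S t θ‖ ≤
      Real.exp (-∑ b ∈ S, Real.exp (-(t * w b)) * (1 - Real.cos (w b * θ))) := by
  rw [boltzmannCharFun, norm_prod, ← Finset.sum_neg_distrib, Real.exp_sum]
  exact Finset.prod_le_prod (fun _ _ => norm_nonneg _) fun b hb =>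
    norm_geometric_charFun_le (Real.exp_pos _) (exp_neg_mul_lt_one ht (hS b hb)) _

open Complex in
lemma continuous_boltzmannCharFun {ι : Type*} (w : ι → ℕ) (S : Finset ι) (hS : ∀ b ∈ S, 0 < w b)
    {t : ℝ} (ht : 0 < t) : Continuous (boltzmannCharFun w S t) := by
  unfold boltzmannCharFun
  refine continuous_finsetProd _ fun b hb => ?_
  refine Continuous.div (by fun_prop) (by fun_prop) fun θ => ?_
  exact one_sub_ofReal_mul_exp_ne_zero (Real.exp_pos _) (exp_neg_mul_lt_one ht (hS b hb)) _

open Complex in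
lemma integral_boltzmannCharFun {ι : Type*} [DecidableEq ι] [Countable ι] (w : ι → ℕ)
    (S : Finset ι) (hS : ∀ b ∈ S, 0 < w b) {t : ℝ} (ht : 0 < t) (k : ℕ) :
    ∫ θ in (-Real.pi)..Real.pi, boltzmannCharFun w S t θ * exp (-(k * θ * I)) =
      2 * Real.pi * (((partSet w S k).ncard * Real.exp (-(t * k)) *
        ∏ b ∈ S, (1 - Real.exp (-(t * w b))) : ℝ) : ℂ) := by
  have h := integral_prod_inv_mul_exp w S hS k (Real.exp_pos (-t)) (by
    rw [Real.exp_lt_one_iff]; linarith)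
  have hpow : ∀ m : ℕ, Real.exp (-t) ^ m = Real.exp (-(t * m)) := by
    intro m
    rw [← Real.exp_nat_mul]
    congr 1
    ring
  have h1 : ∀ θ : ℝ, boltzmannCharFun w S t θ * exp (-(k * θ * I)) =
      (∏ b ∈ S, (1 - (Real.exp (-(t * w b)) : ℂ))) *
      ((∏ b ∈ S, (1 - ((Real.exp (-t) : ℂ) * exp (θ * I)) ^ w b)⁻¹) * exp (-(k * θ * I))) := by
    intro θ
    rw [← mul_assoc, ← Finset.prod_mul_distrib, boltzmannCharFun]
    congr 1
    refine Finset.prod_congr rfl fun b _ => ?_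
    rw [div_eq_mul_inv, mul_pow, ← Complex.exp_nat_mul, ← ofReal_pow, hpow]
    congr 5
    push_cast
    ring
  simp_rw [h1]
  rw [intervalIntegral.integral_const_mul, h, ← ofReal_pow, hpow]
  push_cast
  ring

/-- The area of a block. -/
def blockArea (b : ℕ × ℕ) : ℕ := b.1 * b.2

/-- The blocks with a side of length `1` or `2` and all sides at most `K`. -/
def blockParts (K : ℕ) : Finset (ℕ × ℕ) :=
  ({1} ×ˢ Finset.Icc 1 K) ∪ ({2} ×ˢ Finset.Icc 2 K)

lemma blockArea_pos {K : ℕ} : ∀ b ∈ blockParts K, 0 < blockArea b := by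
  rintro ⟨i, j⟩ h
  simp only [blockParts, Finset.mem_union, Finset.mem_product, Finset.mem_singleton,
    Finset.mem_Icc] at h
  rcases h with h | h
  · exact Nat.mul_pos (by simp [h.1]) (by simp; omega)
  · exact Nat.mul_pos (by simp [h.1]) (by simp; omega)

lemma sum_blockParts {M : Type*} [AddCommMonoid M] (K : ℕ) (f : ℕ × ℕ → M) :
    ∑ b ∈ blockParts K, f b =
      ∑ i ∈ Finset.Icc 1 K, f (1, i) + ∑ j ∈ Finset.Icc 2 K, f (2, j) := by
  rw [blockParts, Finset.sum_union, Finset.sum_product, Finset.sum_product]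
  · simp
  · rw [Finset.disjoint_left]
    rintro ⟨i, j⟩ h1 h2
    simp only [Finset.mem_product, Finset.mem_singleton] at h1 h2
    omega

lemma sum_Icc_le_sum_blockParts (K : ℕ) {f : ℕ × ℕ → ℝ} (hf : ∀ b, 0 ≤ f b) {m : ℕ}
    (hm : m ≤ K) : ∑ i ∈ Finset.Icc 1 m, f (1, i) ≤ ∑ b ∈ blockParts K, f b := by
  rw [sum_blockParts]
  refine le_add_of_le_of_nonneg ?_ (Finset.sum_nonneg fun _ _ => hf _)
  exact Finset.sum_le_sum_of_subset_of_nonneg (Finset.Icc_subset_Icc le_rfl hm)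
    fun _ _ _ => hf _

lemma mul_exp_neg_div_four_le {x : ℝ} (hx : 0 ≤ x) :
    x / 4 * Real.exp (-x / 4) ≤ 1 - Real.exp (-x) := by
  have h1 := Real.add_one_le_exp (x / 4)
  have h2 : Real.exp (-x) ≤ Real.exp (-x / 4) := Real.exp_le_exp.2 (by linarith)
  have h3 : Real.exp (x / 4) * Real.exp (-x / 4) = 1 := by
    rw [← Real.exp_add]; ring_nf; exact Real.exp_zero
  nlinarith [Real.exp_pos (-x / 4)]

lemma sum_exp_neg_Icc_le {t : ℝ} (ht : 0 < t) (K : ℕ) :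
    ∑ i ∈ Finset.Icc 1 K, Real.exp (-(t * i)) ≤ 1 / t := by
  have h1 : Real.exp (-t) < 1 := Real.exp_lt_one_iff.2 (by linarith)
  have hs := hasSum_pow_succ (Real.exp_pos (-t)) h1
  have h2 : ∑ i ∈ Finset.Icc 1 K, Real.exp (-(t * i)) =
      ∑ i ∈ Finset.range K, Real.exp (-t) ^ (i + 1) := by
    rw [Finset.range_eq_Ico, Finset.sum_Ico_add' (fun i => Real.exp (-t) ^ i) 0 K 1]
    refine Finset.sum_congr rfl fun i _ => ?_
    rw [← Real.exp_nat_mul]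
    ring_nf
  rw [h2]
  refine (sum_le_hasSum _ (fun i _ => by positivity) hs).trans ?_
  rw [div_le_div_iff₀ (by linarith) ht]
  have h3 := Real.add_one_le_exp t
  have h4 : Real.exp t * Real.exp (-t) = 1 := by
    rw [← Real.exp_add]; simp
  nlinarith [Real.exp_pos (-t)]

lemma boltzmannMoment_le {t : ℝ} (ht : 0 < t) (K : ℕ) {p : ℕ} (hp : p ≤ 3) :
    boltzmannMoment blockArea (blockParts K) p t ≤ (4 / t) ^ p * (8 / t) := by
  have hterm : ∀ b ∈ blockParts K, (blockArea b : ℝ) ^ p *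
      (Real.exp (-(t * blockArea b)) / (1 - Real.exp (-(t * blockArea b))) ^ p) ≤
      (4 / t) ^ p * Real.exp (-(t / 4 * blockArea b)) := by
    intro b hb
    set x : ℝ := t * blockArea b with hx
    have hw : (0 : ℝ) < blockArea b := by exact_mod_cast blockArea_pos b hb
    have hx0 : 0 < x := mul_pos ht hw
    have h1 := mul_exp_neg_div_four_le hx0.le
    have h2 : 0 < 1 - Real.exp (-x) := by
      have : Real.exp (-x) < 1 := Real.exp_lt_one_iff.2 (by linarith)
      linarith
    have h3 : (blockArea b : ℝ) * Real.exp (-x / 4) / (1 - Real.exp (-x)) ≤ 4 / t := by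
      rw [div_le_div_iff₀ h2 ht]
      calc (blockArea b : ℝ) * Real.exp (-x / 4) * t = 4 * (x / 4 * Real.exp (-x / 4)) := by
            rw [hx]; ring
        _ ≤ _ := by linarith
    have h4 : Real.exp (-x) ≤ Real.exp (-x / 4) ^ p * Real.exp (-(t / 4 * blockArea b)) := by
      rw [← Real.exp_nat_mul, ← Real.exp_add, Real.exp_le_exp]
      have : (p : ℝ) ≤ 3 := by exact_mod_cast hp
      have : t / 4 * blockArea b = x / 4 := by rw [hx]; ring
      rw [this]
      nlinarith
    calc (blockArea b : ℝ) ^ p * (Real.exp (-x) / (1 - Real.exp (-x)) ^ p)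
        ≤ (blockArea b : ℝ) ^ p * ((Real.exp (-x / 4) ^ p * Real.exp (-(t / 4 * blockArea b)))
          / (1 - Real.exp (-x)) ^ p) := by gcongr
      _ = ((blockArea b : ℝ) * Real.exp (-x / 4) / (1 - Real.exp (-x))) ^ p *
          Real.exp (-(t / 4 * blockArea b)) := by
          rw [div_pow, mul_pow]; ring
      _ ≤ _ := by gcongr
  refine (Finset.sum_le_sum hterm).trans ?_
  rw [← Finset.mul_sum]
  gcongr
  rw [sum_blockParts]
  have h1 := sum_exp_neg_Icc_le (t := t / 4) (by positivity) K
  have h2 : ∑ i ∈ Finset.Icc 1 K, Real.exp (-(t / 4 * blockArea (1, i))) ≤ 1 / (t / 4) := by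
    simpa [blockArea] using h1
  have h3 : ∑ i ∈ Finset.Icc 2 K, Real.exp (-(t / 4 * blockArea (2, i))) ≤ 1 / (t / 4) := by
    refine le_trans ?_ h1
    refine (Finset.sum_le_sum fun i _ => ?_).trans
      (Finset.sum_le_sum_of_subset_of_nonneg (Finset.Icc_subset_Icc one_le_two le_rfl)
        fun _ _ _ => (Real.exp_pos _).le)
    rw [Real.exp_le_exp]
    simp only [blockArea, Nat.cast_mul, Nat.cast_ofNat, neg_le_neg_iff]
    have : (0 : ℝ) ≤ t / 4 * i := by positivity
    linarith
  calc _ ≤ 1 / (t / 4) + 1 / (t / 4) := add_le_add h2 h3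
    _ = 8 / t := by field_simp; norm_num

lemma half_inv_le_floor {t : ℝ} (ht : 0 < t) (ht1 : t ≤ 1) : 1 / (2 * t) ≤ ⌊1 / t⌋₊ := by
  have h1 : 1 ≤ 1 / t := by rw [le_div_iff₀ ht]; linarith
  have h2 : (1 : ℝ) ≤ ⌊1 / t⌋₊ := by exact_mod_cast Nat.le_floor (by simpa using h1)
  have h3 := Nat.lt_floor_add_one (1 / t)
  have h4 : 1 / (2 * t) = 1 / t / 2 := by field_simp
  rw [h4]
  linarith

lemma exp_neg_one_gt : (1 : ℝ) / 3 < Real.exp (-1) := by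
  rw [Real.exp_neg, ← one_div]
  exact one_div_lt_one_div_of_lt (Real.exp_pos _) (by linarith [Real.exp_one_lt_d9])

lemma mul_le_one_of_le_floor {t : ℝ} (ht : 0 < t) {c : ℝ} (hc : 0 ≤ c) {i : ℕ}
    (hi : i ≤ ⌊c / t⌋₊) : t * i ≤ c := by
  have : (i : ℝ) ≤ c / t := (Nat.cast_le.2 hi).trans (Nat.floor_le (by positivity))
  rw [le_div_iff₀ ht] at this
  linarith

lemma boltzmannMoment_ge {t : ℝ} (ht : 0 < t) (ht1 : t ≤ 1) {K : ℕ} (hK : 1 / t ≤ K) (p : ℕ) :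
    (1 / t) ^ p * (1 / (6 * t)) ≤ boltzmannMoment blockArea (blockParts K) p t := by
  have hm : ⌊1 / t⌋₊ ≤ K := Nat.floor_le_of_le hK
  have hnn : ∀ b : ℕ × ℕ, 0 ≤ (blockArea b : ℝ) ^ p *
      (Real.exp (-(t * blockArea b)) / (1 - Real.exp (-(t * blockArea b))) ^ p) := by
    intro b
    have : Real.exp (-(t * blockArea b)) ≤ 1 := by
      rw [Real.exp_le_one_iff]
      have : 0 ≤ t * blockArea b := by positivity
      linarith
    have := sub_nonneg.2 this
    positivity
  refine le_trans ?_ (sum_Icc_le_sum_blockParts K hnn hm)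
  have hterm : ∀ i ∈ Finset.Icc 1 ⌊1 / t⌋₊, (1 / t) ^ p * (1 / 3) ≤
      (blockArea (1, i) : ℝ) ^ p * (Real.exp (-(t * blockArea (1, i))) /
        (1 - Real.exp (-(t * blockArea (1, i)))) ^ p) := by
    intro i hi
    rw [Finset.mem_Icc] at hi
    have hi0 : (0 : ℝ) < i := by exact_mod_cast hi.1
    have hti := mul_le_one_of_le_floor ht zero_le_one hi.2
    have e1 : (1 : ℝ) / 3 ≤ Real.exp (-(t * i)) :=
      exp_neg_one_gt.le.trans (Real.exp_le_exp.2 (by linarith))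
    have e2 := Real.add_one_le_exp (-(t * i))
    have e3 : 0 < 1 - Real.exp (-(t * i)) := by
      have : Real.exp (-(t * i)) < 1 := Real.exp_lt_one_iff.2 (by nlinarith)
      linarith
    have e4 : 1 / t ≤ i / (1 - Real.exp (-(t * i))) := by
      rw [div_le_div_iff₀ ht e3]
      linarith
    simp only [blockArea, one_mul]
    calc (1 / t) ^ p * (1 / 3) ≤ (i / (1 - Real.exp (-(t * i)))) ^ p * Real.exp (-(t * i)) := by
          gcongr
      _ = _ := by rw [div_pow]; ring
  have := Finset.card_nsmul_le_sum _ _ _ hterm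
  refine le_trans ?_ this
  rw [Nat.card_Icc, nsmul_eq_mul, Nat.add_sub_cancel]
  have := half_inv_le_floor ht ht1
  calc (1 / t) ^ p * (1 / (6 * t)) = 1 / (2 * t) * ((1 / t) ^ p * (1 / 3)) := by
        field_simp; norm_num
    _ ≤ _ := by gcongr

lemma two_mul_sin_half_mul_sum_cos (θ : ℝ) (m : ℕ) :
    2 * Real.sin (θ / 2) * ∑ i ∈ Finset.Icc 1 m, Real.cos (i * θ) =
      Real.sin ((m + 1 / 2) * θ) - Real.sin (θ / 2) := by
  induction m with
  | zero => simp; ring_nf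
  | succ m ih =>
    rw [Finset.sum_Icc_succ_top (by omega), mul_add, ih]
    have e1 : ((m + 1 : ℕ) + 1 / 2 : ℝ) * θ = (m + 1 : ℕ) * θ + θ / 2 := by ring
    have e2 : (m + 1 / 2 : ℝ) * θ = (m + 1 : ℕ) * θ - θ / 2 := by push_cast; ring
    rw [e1, e2, Real.sin_add, Real.sin_sub]
    ring

lemma sum_cos_le {θ : ℝ} (hθ : 0 < θ) (hπ : θ ≤ Real.pi) (m : ℕ) :
    ∑ i ∈ Finset.Icc 1 m, Real.cos (i * θ) ≤ Real.pi / (2 * θ) := by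
  have h := two_mul_sin_half_mul_sum_cos θ m
  have h1 := Real.mul_le_sin (x := θ / 2) (by linarith) (by linarith)
  have hπ0 := Real.pi_pos
  have h2 : 0 < 2 / Real.pi * (θ / 2) := by positivity
  have h3 := Real.sin_le_one ((m + 1 / 2) * θ)
  rcases le_or_gt (∑ i ∈ Finset.Icc 1 m, Real.cos (i * θ)) 0 with h0 | h0
  · exact h0.trans (by positivity)
  · have h4 : 2 * (2 / Real.pi * (θ / 2)) * ∑ i ∈ Finset.Icc 1 m, Real.cos (i * θ) ≤ 1 := by
      refine le_trans ?_ (show 2 * Real.sin (θ / 2) *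
        ∑ i ∈ Finset.Icc 1 m, Real.cos (i * θ) ≤ 1 by rw [h]; linarith)
      gcongr
    have h5 : 2 * (2 / Real.pi * (θ / 2)) * ∑ i ∈ Finset.Icc 1 m, Real.cos (i * θ) =
      (∑ i ∈ Finset.Icc 1 m, Real.cos (i * θ)) * (2 * θ) / Real.pi := by
      field_simp
    rw [h5, div_le_one hπ0] at h4
    rwa [le_div_iff₀ (by linarith)]

lemma sum_sq_Icc_ge (m : ℕ) : (m : ℝ) ^ 3 / 3 ≤ ∑ i ∈ Finset.Icc 1 m, (i : ℝ) ^ 2 := by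
  induction m with
  | zero => simp
  | succ m ih =>
    rw [Finset.sum_Icc_succ_top (by omega)]
    push_cast
    nlinarith [(Nat.cast_nonneg m : (0 : ℝ) ≤ m)]

lemma sum_exp_mul_one_sub_cos_ge_of_le {t θ : ℝ} (ht : 0 < t) (ht1 : t ≤ 1) {K : ℕ}
    (hK : 1 / t ≤ K) (hθ : |θ| ≤ t) :
    θ ^ 2 / (400 * t ^ 3) ≤
      ∑ b ∈ blockParts K, Real.exp (-(t * blockArea b)) * (1 - Real.cos (blockArea b * θ)) := by
  have hm : ⌊1 / t⌋₊ ≤ K := Nat.floor_le_of_le hK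
  refine le_trans ?_ (sum_Icc_le_sum_blockParts K (fun b =>
    mul_nonneg (Real.exp_pos _).le (sub_nonneg.2 (Real.cos_le_one _))) hm)
  have hterm : ∀ i ∈ Finset.Icc 1 ⌊1 / t⌋₊, 1 / 3 * (1 / 5 * θ ^ 2 * (i : ℝ) ^ 2) ≤
      Real.exp (-(t * blockArea (1, i))) * (1 - Real.cos (blockArea (1, i) * θ)) := by
    intro i hi
    rw [Finset.mem_Icc] at hi
    have hti := mul_le_one_of_le_floor ht zero_le_one hi.2
    have e1 : (1 : ℝ) / 3 ≤ Real.exp (-(t * i)) :=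
      exp_neg_one_gt.le.trans (Real.exp_le_exp.2 (by linarith))
    have e2 : |(i : ℝ) * θ| ≤ Real.pi := by
      rw [abs_mul, Nat.abs_cast]
      have : (i : ℝ) * |θ| ≤ i * t := by gcongr
      linarith [Real.pi_gt_three]
    have e3 := Real.cos_le_one_sub_mul_cos_sq e2
    have e4 : (1 : ℝ) / 5 ≤ 2 / Real.pi ^ 2 := by
      rw [div_le_div_iff₀ (by norm_num) (by positivity)]
      nlinarith [Real.pi_lt_d2, Real.pi_pos]
    have e5 : 1 / 5 * ((i : ℝ) * θ) ^ 2 ≤ 2 / Real.pi ^ 2 * ((i : ℝ) * θ) ^ 2 := by gcongr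
    simp only [blockArea, one_mul]
    refine mul_le_mul e1 ?_ (by positivity) (Real.exp_pos _).le
    calc _ = 1 / 5 * ((i : ℝ) * θ) ^ 2 := by ring
      _ ≤ _ := by linarith
  refine le_trans ?_ (Finset.sum_le_sum hterm)
  rw [← Finset.mul_sum, ← Finset.mul_sum]
  have h1 := sum_sq_Icc_ge ⌊1 / t⌋₊
  have h2 : (1 / (2 * t)) ^ 3 / 3 ≤ (⌊1 / t⌋₊ : ℝ) ^ 3 / 3 := by
    have := half_inv_le_floor ht ht1
    gcongr
  calc θ ^ 2 / (400 * t ^ 3) ≤ θ ^ 2 / (360 * t ^ 3) := by gcongr; norm_num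
    _ = 1 / 3 * (1 / 5 * θ ^ 2 * ((1 / (2 * t)) ^ 3 / 3)) := by field_simp; ring
    _ ≤ _ := by gcongr; exact h2.trans h1

lemma sum_exp_mul_one_sub_cos_ge_of_ge {t θ : ℝ} (ht : 0 < t) (ht1 : t ≤ 1) {K : ℕ}
    (hK : 4 / t ≤ K) (hθ : t ≤ |θ|) (hπ : |θ| ≤ Real.pi) :
    1 / (100 * t) ≤
      ∑ b ∈ blockParts K, Real.exp (-(t * blockArea b)) * (1 - Real.cos (blockArea b * θ)) := by
  have hm : ⌊4 / t⌋₊ ≤ K := Nat.floor_le_of_le hK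
  refine le_trans ?_ (sum_Icc_le_sum_blockParts K (fun b =>
    mul_nonneg (Real.exp_pos _).le (sub_nonneg.2 (Real.cos_le_one _))) hm)
  have hterm : ∀ i ∈ Finset.Icc 1 ⌊4 / t⌋₊, 1 / 81 * (1 - Real.cos (i * |θ|)) ≤
      Real.exp (-(t * blockArea (1, i))) * (1 - Real.cos (blockArea (1, i) * θ)) := by
    intro i hi
    rw [Finset.mem_Icc] at hi
    have hti := mul_le_one_of_le_floor ht (by norm_num : (0 : ℝ) ≤ 4) hi.2
    have e1 : (1 : ℝ) / 81 ≤ Real.exp (-(t * i)) := by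
      calc (1 : ℝ) / 81 = (1 / 3) ^ 4 := by norm_num
        _ ≤ Real.exp (-1) ^ 4 := by gcongr; exact exp_neg_one_gt.le
        _ = Real.exp (-4) := by rw [← Real.exp_nat_mul]; norm_num
        _ ≤ _ := Real.exp_le_exp.2 (by linarith)
    have e2 : Real.cos (i * |θ|) = Real.cos (i * θ) := by
      rw [← Real.cos_abs (i * θ), abs_mul, Nat.abs_cast]
    simp only [blockArea, one_mul]
    rw [e2]
    exact mul_le_mul_of_nonneg_right e1 (sub_nonneg.2 (Real.cos_le_one _))
  refine le_trans ?_ (Finset.sum_le_sum hterm)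
  rw [← Finset.mul_sum, Finset.sum_sub_distrib, Finset.sum_const, Nat.card_Icc, nsmul_eq_mul,
    Nat.add_sub_cancel, mul_one]
  have h1 := sum_cos_le (ht.trans_le hθ) hπ ⌊4 / t⌋₊
  have h2 : Real.pi / (2 * |θ|) ≤ 1.6 / t := by
    rw [div_le_div_iff₀ (by linarith) ht]
    nlinarith [Real.pi_lt_d2]
  have h3 := Nat.lt_floor_add_one (4 / t)
  have h4 : 1 ≤ 1 / t := by rw [le_div_iff₀ ht]; linarith
  have h5 : 4 / t = 4 * (1 / t) := by ring
  have h6 : 1.6 / t = 1.6 * (1 / t) := by ring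
  have h7 : 1 / (100 * t) = 1 / 100 * (1 / t) := by field_simp
  rw [h7]
  linarith

lemma norm_boltzmannCharFun_div_sqrt_le {t v : ℝ} (ht : 0 < t) (ht1 : t ≤ 1) {K : ℕ}
    (hK : 4 / t ≤ K)
    (hv : |v| ≤ Real.pi * √(boltzmannMoment blockArea (blockParts K) 2 t)) :
    ‖boltzmannCharFun blockArea (blockParts K) t
      (v / √(boltzmannMoment blockArea (blockParts K) 2 t))‖ ≤ 10 ^ 10 * (1 + v ^ 2)⁻¹ := by
  set b := boltzmannMoment blockArea (blockParts K) 2 t with hb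
  have hK1 : 1 / t ≤ K := le_trans (by gcongr; norm_num) hK
  have hb1 : (1 / t) ^ 2 * (1 / (6 * t)) ≤ b := boltzmannMoment_ge ht ht1 hK1 2
  have hb2 : b ≤ (4 / t) ^ 2 * (8 / t) := boltzmannMoment_le ht K (by norm_num)
  have hb0 : 0 < b := lt_of_lt_of_le (by positivity) hb1
  have hσ : 0 < √b := Real.sqrt_pos.2 hb0
  have hbt : b * t ^ 3 ≤ 128 := by
    calc b * t ^ 3 ≤ (4 / t) ^ 2 * (8 / t) * t ^ 3 := by gcongr
      _ = 128 := by field_simp; norm_num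
  refine (norm_boltzmannCharFun_le _ _ blockArea_pos ht _).trans ?_
  rw [Real.exp_neg, ← one_div, ← div_eq_mul_inv]
  have key : ∀ {x : ℝ}, 0 ≤ x → x ≤ ∑ b ∈ blockParts K, Real.exp (-(t * blockArea b)) *
      (1 - Real.cos (blockArea b * (v / √(boltzmannMoment blockArea (blockParts K) 2 t)))) →
      1 + v ^ 2 ≤ 10 ^ 10 * (1 + x + x ^ 3 / 6) → 1 / Real.exp (∑ b ∈ blockParts K,
      Real.exp (-(t * blockArea b)) *
      (1 - Real.cos (blockArea b * (v / √(boltzmannMoment blockArea (blockParts K) 2 t))))) ≤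
      10 ^ 10 / (1 + v ^ 2) := by
    intro x hx0 hx h
    rw [div_le_div_iff₀ (Real.exp_pos _) (by positivity), one_mul]
    refine h.trans ?_
    have h1 := Real.sum_le_exp_of_nonneg hx0 4
    simp [Finset.sum_range_succ, Nat.factorial] at h1
    have := Real.exp_le_exp.2 hx
    nlinarith [sq_nonneg x]
  rcases le_total |v / √b| t with h | h
  · refine key ?_ (sum_exp_mul_one_sub_cos_ge_of_le ht ht1 hK1 h) ?_
    · positivity
    · have h1 : v ^ 2 / 51200 ≤ (v / √b) ^ 2 / (400 * t ^ 3) := by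
        rw [div_pow, Real.sq_sqrt hb0.le, div_div]
        gcongr
        linarith
      have h2 : 0 ≤ ((v / √b) ^ 2 / (400 * t ^ 3)) ^ 3 / 6 := by positivity
      nlinarith [sq_nonneg v]
  · refine key ?_ (sum_exp_mul_one_sub_cos_ge_of_ge ht ht1 hK h ?_) ?_
    · positivity
    · rw [abs_div, abs_of_pos hσ, div_le_iff₀ hσ]
      exact hv
    · have h1 : v ^ 2 ≤ 1280 * (1 / t) ^ 3 := by
        have : v ^ 2 ≤ Real.pi ^ 2 * b := by
          rw [← sq_abs, ← Real.sq_sqrt hb0.le, ← mul_pow]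
          gcongr
        have hp : Real.pi ^ 2 ≤ 10 := by nlinarith [Real.pi_lt_d2, Real.pi_pos]
        calc v ^ 2 ≤ 10 * b := this.trans (by gcongr)
          _ ≤ 10 * ((4 / t) ^ 2 * (8 / t)) := by gcongr
          _ = _ := by ring
      have h2 : (1 / (100 * t)) ^ 3 / 6 = (1 / t) ^ 3 / (6 * 10 ^ 6) := by field_simp; norm_num
      rw [h2]
      have : 0 < 1 / (100 * t) := by positivity
      have : 0 < (1 / t) ^ 3 := by positivity
      linarith

lemma exists_boltzmannMoment_eq {n : ℕ} (hn : 256 ≤ n) :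
    ∃ t : ℝ, 1 / (4 * √n) ≤ t ∧ t ≤ 4 / √n ∧
      boltzmannMoment blockArea (blockParts (4 * n)) 1 t = 2 * n := by
  have hn' : (256 : ℝ) ≤ n := by exact_mod_cast hn
  have hs : (16 : ℝ) ≤ √n := Real.le_sqrt_of_sq_le (by linarith)
  have hsq : √(n : ℝ) ^ 2 = n := Real.sq_sqrt (by linarith)
  have hle : 1 / (4 * √(n : ℝ)) ≤ 4 / √n := by
    rw [div_le_div_iff₀ (by positivity) (by positivity)]
    nlinarith
  have hcont : ContinuousOn (boltzmannMoment blockArea (blockParts (4 * n)) 1)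
      (Set.Icc (1 / (4 * √n)) (4 / √n)) := by
    unfold boltzmannMoment
    refine continuousOn_finsetSum _ fun b hb => ?_
    refine ContinuousOn.mul (by fun_prop) (ContinuousOn.div (by fun_prop) (by fun_prop) ?_)
    intro t ht
    have ht0 : 0 < t := lt_of_lt_of_le (by positivity) ht.1
    have := exp_neg_mul_lt_one ht0 (blockArea_pos b hb)
    exact pow_ne_zero _ (by linarith)
  have h := intermediate_value_Icc' hle hcont
  have hmem : (2 * n : ℝ) ∈ Set.Icc (boltzmannMoment blockArea (blockParts (4 * n)) 1 (4 / √n))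
      (boltzmannMoment blockArea (blockParts (4 * n)) 1 (1 / (4 * √n))) := by
    constructor
    · refine (boltzmannMoment_le (by positivity) _ (by norm_num)).trans (le_of_eq ?_)
      have : (4 / (4 / √(n : ℝ))) ^ 1 * (8 / (4 / √n)) = 2 * √n ^ 2 := by
        field_simp; norm_num
      rw [this, hsq]
    · refine le_trans ?_ (boltzmannMoment_ge (by positivity) ?_ ?_ 1)
      · have : (1 / (1 / (4 * √(n : ℝ)))) ^ 1 * (1 / (6 * (1 / (4 * √n)))) = 8 / 3 * √n ^ 2 := by
          field_simp; norm_num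
        rw [this, hsq]
        linarith
      · rw [div_le_one (by positivity)]
        linarith
      · rw [one_div_one_div]
        push_cast
        nlinarith
  obtain ⟨t, ht, h⟩ := h hmem
  exact ⟨t, ht.1, ht.2, h⟩

section

open Filter Topology

/-- A parameter at which the Boltzmann distribution has mean weight `2 * n`. -/
noncomputable def saddlePoint (n : ℕ) : ℝ :=
  if h : 256 ≤ n then (exists_boltzmannMoment_eq h).choose else 1

lemma saddlePoint_spec {n : ℕ} (hn : 256 ≤ n) :
    1 / (4 * √n) ≤ saddlePoint n ∧ saddlePoint n ≤ 4 / √n ∧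
      boltzmannMoment blockArea (blockParts (4 * n)) 1 (saddlePoint n) = 2 * n := by
  rw [saddlePoint, dif_pos hn]
  exact (exists_boltzmannMoment_eq hn).choose_spec

lemma sixteen_le_sqrt {n : ℕ} (hn : 256 ≤ n) : (16 : ℝ) ≤ √n := by
  have hn' : (256 : ℝ) ≤ n := by exact_mod_cast hn
  exact Real.le_sqrt_of_sq_le (by linarith)

lemma saddlePoint_pos (n : ℕ) : 0 < saddlePoint n := by
  by_cases hn : 256 ≤ n
  · have := sixteen_le_sqrt hn
    exact lt_of_lt_of_le (by positivity) (saddlePoint_spec hn).1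
  · rw [saddlePoint, dif_neg hn]
    exact one_pos

lemma saddlePoint_le_one (n : ℕ) : saddlePoint n ≤ 1 := by
  by_cases hn : 256 ≤ n
  · have := sixteen_le_sqrt hn
    refine (saddlePoint_spec hn).2.1.trans ?_
    rw [div_le_one (by linarith)]
    linarith
  · rw [saddlePoint, dif_neg hn]

lemma four_div_saddlePoint_le {n : ℕ} (hn : 256 ≤ n) :
    4 / saddlePoint n ≤ ((4 * n : ℕ) : ℝ) := by
  have h1 := (saddlePoint_spec hn).1
  have h2 := sixteen_le_sqrt hn
  have h3 : √(n : ℝ) ^ 2 = n := Real.sq_sqrt (Nat.cast_nonneg n)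
  rw [div_le_iff₀ (saddlePoint_pos n)]
  calc (4 : ℝ) ≤ √n := by linarith
    _ = (4 * √n ^ 2) * (1 / (4 * √n)) := by field_simp
    _ ≤ _ := by rw [h3]; push_cast; gcongr

/-- The standard deviation scale of the Boltzmann distribution at the saddle point. -/
noncomputable def saddleScale (n : ℕ) : ℝ :=
  √(boltzmannMoment blockArea (blockParts (4 * n)) 2 (saddlePoint n))

lemma boltzmannMoment_two_ge {n : ℕ} (hn : 256 ≤ n) :
    1 / (6 * saddlePoint n ^ 3) ≤
      boltzmannMoment blockArea (blockParts (4 * n)) 2 (saddlePoint n) := by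
  have ht := saddlePoint_pos n
  refine le_trans (le_of_eq ?_) (boltzmannMoment_ge ht (saddlePoint_le_one n)
    (le_trans (by gcongr; norm_num) (four_div_saddlePoint_le hn)) 2)
  field_simp

lemma saddleScale_sq {n : ℕ} (hn : 256 ≤ n) : saddleScale n ^ 2 =
    boltzmannMoment blockArea (blockParts (4 * n)) 2 (saddlePoint n) := by
  have ht := saddlePoint_pos n
  exact Real.sq_sqrt (le_trans (by positivity) (boltzmannMoment_two_ge hn))

lemma sqrt_cube_le_saddleScale_sq {n : ℕ} (hn : 256 ≤ n) :
    √n ^ 3 / 384 ≤ saddleScale n ^ 2 := by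
  have ht := saddlePoint_pos n
  have h2 := sixteen_le_sqrt hn
  have h1 := (saddlePoint_spec hn).2.1
  rw [saddleScale_sq hn]
  refine le_trans ?_ (boltzmannMoment_two_ge hn)
  calc √n ^ 3 / 384 = 1 / (6 * (4 / √(n : ℝ)) ^ 3) := by field_simp; norm_num
    _ ≤ _ := by gcongr

lemma saddleScale_pos {n : ℕ} (hn : 256 ≤ n) : 0 < saddleScale n := by
  have h1 := sqrt_cube_le_saddleScale_sq hn
  have h2 := sixteen_le_sqrt hn
  have h3 : 0 < √(n : ℝ) ^ 3 / 384 := by positivity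
  rcases (Real.sqrt_nonneg _ : 0 ≤ saddleScale n).lt_or_eq with h | h
  · exact h
  · rw [show saddleScale n = 0 from h.symm] at h1
    norm_num at h1
    linarith

lemma saddleScale_le {n : ℕ} (hn : 256 ≤ n) : saddleScale n ≤ 100 * n := by
  have ht := saddlePoint_pos n
  have h2 := sixteen_le_sqrt hn
  have h3 : √(n : ℝ) ^ 2 = n := Real.sq_sqrt (Nat.cast_nonneg n)
  have h1 := (saddlePoint_spec hn).1
  have h4 : saddleScale n ^ 2 ≤ (4 / saddlePoint n) ^ 2 * (8 / saddlePoint n) := by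
    rw [saddleScale_sq hn]
    exact boltzmannMoment_le ht _ (by norm_num)
  refine abs_le_of_sq_le_sq' ?_ (by positivity) |>.2
  calc saddleScale n ^ 2 ≤ (4 / saddlePoint n) ^ 2 * (8 / saddlePoint n) := h4
    _ ≤ (4 / (1 / (4 * √n))) ^ 2 * (8 / (1 / (4 * √n))) := by gcongr
    _ = 8192 * √n ^ 3 := by field_simp; norm_num
    _ ≤ 10000 * (√n ^ 3 * √n) := by
        have : 0 < √(n : ℝ) ^ 3 := by positivity
        nlinarith
    _ = (100 * √n ^ 2) ^ 2 := by ring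
    _ = (100 * n) ^ 2 := by rw [h3]

lemma tendsto_sqrt_natCast : Tendsto (fun n : ℕ => √(n : ℝ)) atTop atTop :=
  Real.tendsto_sqrt_atTop.comp tendsto_natCast_atTop_atTop

lemma tendsto_saddlePoint : Tendsto saddlePoint atTop (𝓝 0) := by
  refine squeeze_zero' (Eventually.of_forall fun n => (saddlePoint_pos n).le) ?_
    (tendsto_sqrt_natCast.const_div_atTop 4)
  filter_upwards [eventually_ge_atTop 256] with n hn using (saddlePoint_spec hn).2.1

lemma tendsto_saddleScale : Tendsto saddleScale atTop atTop := by
  have h : Tendsto (fun n => saddleScale n ^ 2) atTop atTop := by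
    refine tendsto_atTop_mono' _ ?_
      (((tendsto_pow_atTop (by norm_num : (3 : ℕ) ≠ 0)).comp
        tendsto_sqrt_natCast).atTop_div_const (by norm_num : (0 : ℝ) < 384))
    filter_upwards [eventually_ge_atTop 256] with n hn using sqrt_cube_le_saddleScale_sq hn
  have h2 := Real.tendsto_sqrt_atTop.comp h
  refine h2.congr fun n => ?_
  simp only [Function.comp_apply]
  exact Real.sqrt_sq (Real.sqrt_nonneg _)

lemma tendsto_boltzmannMoment_three_div :
    Tendsto (fun n => boltzmannMoment blockArea (blockParts (4 * n)) 3 (saddlePoint n) /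
      saddleScale n ^ 3) atTop (𝓝 0) := by
  have hlim : Tendsto (fun n => √(512 ^ 2 * 216 * saddlePoint n)) atTop (𝓝 0) := by
    have := (tendsto_saddlePoint.const_mul (512 ^ 2 * 216)).sqrt
    simpa using this
  have hnn : ∀ n, 0 ≤ boltzmannMoment blockArea (blockParts (4 * n)) 3 (saddlePoint n) := by
    intro n
    refine Finset.sum_nonneg fun b hb => ?_
    have := exp_neg_mul_lt_one (saddlePoint_pos n) (blockArea_pos b hb)
    have : 0 < 1 - Real.exp (-(saddlePoint n * blockArea b)) := by linarith
    positivity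
  refine squeeze_zero' (Eventually.of_forall fun n => ?_) ?_ hlim
  · have : 0 ≤ saddleScale n := Real.sqrt_nonneg _
    have := hnn n
    positivity
  · filter_upwards [eventually_ge_atTop 256] with n hn
    have ht := saddlePoint_pos n
    have hσ := saddleScale_pos hn
    refine Real.le_sqrt_of_sq_le ?_
    have h1 : boltzmannMoment blockArea (blockParts (4 * n)) 3 (saddlePoint n) ≤ _ :=
      boltzmannMoment_le ht _ le_rfl
    have h2 := boltzmannMoment_two_ge hn
    rw [← saddleScale_sq hn] at h2
    rw [div_pow, show (saddleScale n ^ 3) ^ 2 = (saddleScale n ^ 2) ^ 3 by ring,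
      div_le_iff₀ (by positivity)]
    calc boltzmannMoment blockArea (blockParts (4 * n)) 3 (saddlePoint n) ^ 2
        ≤ ((4 / saddlePoint n) ^ 3 * (8 / saddlePoint n)) ^ 2 := by
          have := hnn n
          gcongr
      _ = 512 ^ 2 * 216 * saddlePoint n * (1 / (6 * saddlePoint n ^ 3)) ^ 3 := by
          field_simp; norm_num
      _ ≤ _ := by gcongr

/-- The Boltzmann probability of total weight `k` at the saddle point. -/
noncomputable def boltzmannProb (n k : ℕ) : ℝ :=
  (partSet blockArea (blockParts (4 * n)) k).ncard * Real.exp (-(saddlePoint n * k)) *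
    ∏ b ∈ blockParts (4 * n), (1 - Real.exp (-(saddlePoint n * blockArea b)))

open Complex in
lemma two_pi_mul_scale_mul_boltzmannProb {n : ℕ} (hn : 256 ≤ n) (k : ℕ) :
    ((2 * Real.pi * (saddleScale n * boltzmannProb n k) : ℝ) : ℂ) =
      ∫ v : ℝ, (Set.Ioc (-(Real.pi * saddleScale n)) (Real.pi * saddleScale n)).indicator
        (fun v => boltzmannCharFun blockArea (blockParts (4 * n)) (saddlePoint n)
          (v / saddleScale n) * exp (-(k * ((v / saddleScale n : ℝ) : ℂ) * I))) v := by
  have hσ := saddleScale_pos hn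
  have hπ := Real.pi_pos
  rw [MeasureTheory.integral_indicator measurableSet_Ioc,
    ← intervalIntegral.integral_of_le (by nlinarith),
    intervalIntegral.integral_comp_div (fun θ => boltzmannCharFun blockArea (blockParts (4 * n))
      (saddlePoint n) θ * exp (-(k * (θ : ℂ) * I))) hσ.ne',
    show -(Real.pi * saddleScale n) / saddleScale n = -Real.pi by field_simp,
    show Real.pi * saddleScale n / saddleScale n = Real.pi by field_simp,
    integral_boltzmannCharFun _ _ blockArea_pos (saddlePoint_pos n)]
  rw [boltzmannProb, real_smul]
  push_cast
  ring

open Complex in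
lemma tendsto_boltzmannCharFun_mul_exp {κ : ℕ → ℕ}
    (hκ : Tendsto (fun n => ((κ n : ℝ) - 2 * n) / saddleScale n) atTop (𝓝 0)) (v : ℝ) :
    Tendsto (fun n => boltzmannCharFun blockArea (blockParts (4 * n)) (saddlePoint n)
      (v / saddleScale n) * exp (-(κ n * ((v / saddleScale n : ℝ) : ℂ) * I))) atTop
      (𝓝 ((Real.exp (-(1 / 2) * v ^ 2) : ℝ) : ℂ)) := by
  choose e he1 he2 using fun n => boltzmannCharFun_eq_exp blockArea (blockParts (4 * n))
    blockArea_pos (saddlePoint_pos n) (v / saddleScale n)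
  have he : Tendsto e atTop (𝓝 0) := by
    refine squeeze_zero_norm' ?_ (by
      simpa using tendsto_boltzmannMoment_three_div.const_mul (8 * |v| ^ 3))
    filter_upwards [eventually_ge_atTop 256] with n hn
    refine (he1 n).trans (le_of_eq ?_)
    rw [abs_div, abs_of_pos (saddleScale_pos hn)]
    ring
  have hlim : Tendsto (fun n => exp (-((v : ℂ) ^ 2 / 2) -
      (((((κ n : ℝ) - 2 * n) / saddleScale n : ℝ) : ℂ)) * v * I + e n)) atTop
      (𝓝 (exp (-((v : ℂ) ^ 2 / 2) - ((0 : ℝ) : ℂ) * v * I + 0))) := by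
    refine (continuous_exp.tendsto _).comp ?_
    refine Tendsto.add (Tendsto.sub tendsto_const_nhds ?_) he
    exact ((((continuous_ofReal.tendsto 0).comp hκ).mul_const _).mul_const _)
  have hval : ((Real.exp (-(1 / 2) * v ^ 2) : ℝ) : ℂ) =
      exp (-((v : ℂ) ^ 2 / 2) - ((0 : ℝ) : ℂ) * v * I + 0) := by
    push_cast
    congr 1
    ring
  rw [hval]
  refine hlim.congr' ?_
  filter_upwards [eventually_ge_atTop 256] with n hn
  have hσ := saddleScale_pos hn
  rw [he2 n, ← Complex.exp_add, (saddlePoint_spec hn).2.2, ← saddleScale_sq hn]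
  congr 1
  have hσ' : (saddleScale n : ℂ) ≠ 0 := by exact_mod_cast hσ.ne'
  push_cast
  field_simp
  ring

open Complex in
/-- Local limit theorem for the Boltzmann distribution at the saddle point. -/
lemma tendsto_scale_mul_boltzmannProb {κ : ℕ → ℕ}
    (hκ : Tendsto (fun n => ((κ n : ℝ) - 2 * n) / saddleScale n) atTop (𝓝 0)) :
    Tendsto (fun n => 2 * Real.pi * (saddleScale n * boltzmannProb n (κ n))) atTop
      (𝓝 √(2 * Real.pi)) := by
  have hgauss : ∫ v : ℝ, ((Real.exp (-(1 / 2) * v ^ 2) : ℝ) : ℂ) = ((√(2 * Real.pi) : ℝ) : ℂ) := by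
    rw [integral_complex_ofReal, integral_gaussian]
    norm_num [mul_comm]
  have h : Tendsto (fun n => ((2 * Real.pi * (saddleScale n * boltzmannProb n (κ n)) : ℝ) : ℂ))
      atTop (𝓝 ((√(2 * Real.pi) : ℝ) : ℂ)) := by
    rw [← hgauss]
    refine Tendsto.congr' (f₁ := fun n => ∫ v : ℝ, (Set.Ioc (-(Real.pi * saddleScale n))
        (Real.pi * saddleScale n)).indicator
        (fun v => boltzmannCharFun blockArea (blockParts (4 * n)) (saddlePoint n)
          (v / saddleScale n) * exp (-(κ n * ((v / saddleScale n : ℝ) : ℂ) * I))) v) ?_ ?_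
    · filter_upwards [eventually_ge_atTop 256] with n hn
      rw [two_pi_mul_scale_mul_boltzmannProb hn]
    refine MeasureTheory.tendsto_integral_filter_of_dominated_convergence
      (fun v => 10 ^ 10 * (1 + v ^ 2)⁻¹) ?_ ?_ (integrable_inv_one_add_sq.const_mul _) ?_
    · refine Eventually.of_forall fun n => ?_
      refine (Continuous.aestronglyMeasurable ?_).indicator measurableSet_Ioc
      refine Continuous.mul ?_ (by fun_prop)
      exact (continuous_boltzmannCharFun _ _ blockArea_pos (saddlePoint_pos n)).comp (by fun_prop)
    · filter_upwards [eventually_ge_atTop 256] with n hn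
      refine Eventually.of_forall fun v => ?_
      by_cases hv : v ∈ Set.Ioc (-(Real.pi * saddleScale n)) (Real.pi * saddleScale n)
      · rw [Set.indicator_of_mem hv, norm_mul]
        have h1 : ‖exp (-(κ n * ((v / saddleScale n : ℝ) : ℂ) * I))‖ = 1 := by
          rw [show -(κ n * ((v / saddleScale n : ℝ) : ℂ) * I) =
            ((-(κ n * (v / saddleScale n)) : ℝ) : ℂ) * I by push_cast; ring]
          exact norm_exp_ofReal_mul_I _
        rw [h1, mul_one]
        exact norm_boltzmannCharFun_div_sqrt_le (saddlePoint_pos n) (saddlePoint_le_one n)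
          (four_div_saddlePoint_le hn) (abs_le.2 ⟨hv.1.le, hv.2⟩)
      · rw [Set.indicator_of_notMem hv, norm_zero]
        positivity
    · refine Eventually.of_forall fun v => ?_
      refine (tendsto_boltzmannCharFun_mul_exp hκ v).congr' ?_
      filter_upwards [tendsto_saddleScale.eventually_ge_atTop |v|,
        tendsto_saddleScale.eventually_gt_atTop 0] with n hn h0
      rw [Set.indicator_of_mem]
      have := neg_abs_le v
      have := le_abs_self v
      have := Real.pi_gt_three
      constructor <;> nlinarith
  exact_mod_cast (continuous_re.tendsto _).comp h

/-- The number of multisets of blocks of total area `k` with each block fitting into a strip of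
width `2`. -/
noncomputable def blockCount (k : ℕ) : ℕ := (partSet blockArea (blockParts k) k).ncard

lemma partSet_blockParts_eq {k K : ℕ} (h : k ≤ K) :
    partSet blockArea (blockParts K) k = partSet blockArea (blockParts k) k := by
  ext M
  constructor
  · rintro ⟨h1, h2⟩
    refine ⟨fun b hb => ?_, h2⟩
    have hb1 := h1 b hb
    have hb2 := weight_le_totalWeight blockArea hb
    rw [h2] at hb2
    obtain ⟨i, j⟩ := b
    simp only [blockParts, Finset.mem_union, Finset.mem_product, Finset.mem_singleton,
      Finset.mem_Icc, blockArea] at *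
    rcases hb1 with ⟨rfl, h3⟩ | ⟨rfl, h3⟩
    · left; refine ⟨rfl, ?_⟩; omega
    · right; refine ⟨rfl, ?_⟩; omega
  · rintro ⟨h1, h2⟩
    refine ⟨fun b hb => ?_, h2⟩
    have hb1 := h1 b hb
    obtain ⟨i, j⟩ := b
    simp only [blockParts, Finset.mem_union, Finset.mem_product, Finset.mem_singleton,
      Finset.mem_Icc] at *
    omega

lemma blockCount_pos {k : ℕ} (hk : 0 < k) : 0 < blockCount k := by
  rw [blockCount, Set.ncard_pos (partSet_finite _ _ blockArea_pos k)]
  refine ⟨{(1, k)}, ?_, by simp [totalWeight, blockArea]⟩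
  simp [blockParts]
  omega

lemma boltzmannProb_eq {n k : ℕ} (hk : k ≤ 4 * n) :
    boltzmannProb n k = blockCount k * Real.exp (-(saddlePoint n * k)) *
    ∏ b ∈ blockParts (4 * n), (1 - Real.exp (-(saddlePoint n * blockArea b))) := by
  rw [boltzmannProb, partSet_blockParts_eq hk, blockCount]

lemma tendsto_sub_div_saddleScale {κ : ℕ → ℕ} {C : ℝ}
    (hκ : ∀ᶠ n : ℕ in atTop, |(κ n : ℝ) - 2 * n| ≤ C * √n) :
    Tendsto (fun n => ((κ n : ℝ) - 2 * n) / saddleScale n) atTop (𝓝 0) := by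
  have hlim : Tendsto (fun n : ℕ => √(C ^ 2 * (384 / √(n : ℝ)))) atTop (𝓝 0) := by
    have := ((tendsto_sqrt_natCast.const_div_atTop 384).const_mul (C ^ 2)).sqrt
    simpa using this
  refine squeeze_zero_norm' ?_ hlim
  filter_upwards [eventually_ge_atTop 256, hκ] with n hn h
  have hσ := saddleScale_pos hn
  have h1 := sqrt_cube_le_saddleScale_sq hn
  have h2 := sixteen_le_sqrt hn
  rw [Real.norm_eq_abs, abs_div, abs_of_pos hσ]
  refine Real.le_sqrt_of_sq_le ?_
  rw [div_pow, div_le_iff₀ (by positivity)]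
  calc |(κ n : ℝ) - 2 * n| ^ 2 ≤ (C * √n) ^ 2 := by gcongr
    _ = C ^ 2 * (384 / √(n : ℝ)) * (√n ^ 3 / 384) := by field_simp
    _ ≤ _ := by gcongr

lemma prod_one_sub_exp_pos (n : ℕ) :
    0 < ∏ b ∈ blockParts (4 * n), (1 - Real.exp (-(saddlePoint n * blockArea b))) :=
  Finset.prod_pos fun b hb => sub_pos.2 (exp_neg_mul_lt_one (saddlePoint_pos n) (blockArea_pos b hb))

/-- The ratio of the numbers of block multisets of nearby total areas. -/
lemma tendsto_blockCount_div {κ : ℕ → ℕ} {C : ℝ}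
    (hκ : ∀ᶠ n : ℕ in atTop, |(κ n : ℝ) - 2 * n| ≤ C * √n) :
    Tendsto (fun n => blockCount (κ n) * Real.exp (-(saddlePoint n * (κ n - 2 * n))) /
      blockCount (2 * n)) atTop (𝓝 1) := by
  have h1 := tendsto_scale_mul_boltzmannProb (tendsto_sub_div_saddleScale hκ)
  have h2 := tendsto_scale_mul_boltzmannProb (κ := fun n => 2 * n) (by simp)
  have h0 : √(2 * Real.pi) ≠ 0 := by positivity
  have h3 := h1.div h2 h0
  rw [div_self h0] at h3
  refine h3.congr' ?_
  filter_upwards [eventually_ge_atTop 256, hκ, tendsto_sqrt_natCast.eventually_ge_atTop C]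
    with n hn h hC
  have hσ := saddleScale_pos hn
  have hle : κ n ≤ 4 * n := by
    have h5 : √(n : ℝ) ^ 2 = n := Real.sq_sqrt (Nat.cast_nonneg n)
    have : (κ n : ℝ) ≤ 4 * n := by
      have := (abs_le.1 h).2
      have h2 := sixteen_le_sqrt hn
      nlinarith
    exact_mod_cast this
  have hP := prod_one_sub_exp_pos n
  have hg : (0 : ℝ) < blockCount (2 * n) := by exact_mod_cast blockCount_pos (by omega)
  simp only [Pi.div_apply]
  rw [boltzmannProb_eq hle, boltzmannProb_eq (show 2 * n ≤ 4 * n by omega)]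
  have he : Real.exp (-(saddlePoint n * (κ n - 2 * n))) =
      Real.exp (-(saddlePoint n * κ n)) / Real.exp (-(saddlePoint n * ((2 * n : ℕ) : ℝ))) := by
    rw [← Real.exp_sub]
    push_cast
    ring_nf
  rw [he]
  have hπ := Real.pi_pos
  have := Real.exp_pos (-(saddlePoint n * ((2 * n : ℕ) : ℝ)))
  field_simp

lemma eventually_exp_mul_prod_le :
    ∀ᶠ n : ℕ in atTop, Real.exp (2 * n * saddlePoint n) *
      ∏ b ∈ blockParts (4 * n), (1 - Real.exp (-(saddlePoint n * blockArea b)))⁻¹ ≤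
      300 * n * blockCount (2 * n) := by
  have h2 := tendsto_scale_mul_boltzmannProb (κ := fun n => 2 * n) (by simp)
  have h3 : 2 * Real.pi / 3 < √(2 * Real.pi) := by
    refine Real.lt_sqrt_of_sq_lt ?_
    nlinarith [Real.pi_lt_d2, Real.pi_pos]
  filter_upwards [eventually_ge_atTop 256, h2.eventually_const_lt h3] with n hn h
  have hP := prod_one_sub_exp_pos n
  rw [boltzmannProb_eq (show 2 * n ≤ 4 * n by omega)] at h
  have hπ := Real.pi_pos
  have h4 : 1 / 3 ≤ saddleScale n * (blockCount (2 * n) *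
      Real.exp (-(saddlePoint n * ((2 * n : ℕ) : ℝ))) *
    ∏ b ∈ blockParts (4 * n), (1 - Real.exp (-(saddlePoint n * blockArea b)))) := by
    by_contra hc
    push Not at hc
    nlinarith
  have h5 := saddleScale_le hn
  rw [Finset.prod_inv_distrib, ← div_eq_mul_inv, div_le_iff₀ hP]
  have h6 : Real.exp (2 * n * saddlePoint n) * Real.exp (-(saddlePoint n * ((2 * n : ℕ) : ℝ))) = 1 := by
    rw [← Real.exp_add]
    push_cast
    ring_nf
    exact Real.exp_zero
  set E := Real.exp (-(saddlePoint n * ((2 * n : ℕ) : ℝ)))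
  set P := ∏ b ∈ blockParts (4 * n), (1 - Real.exp (-(saddlePoint n * blockArea b)))
  have hX : 0 < Real.exp (2 * n * saddlePoint n) := Real.exp_pos _
  calc Real.exp (2 * n * saddlePoint n) = 3 * Real.exp (2 * n * saddlePoint n) * (1 / 3) := by ring
    _ ≤ 3 * Real.exp (2 * n * saddlePoint n) *
        (saddleScale n * (blockCount (2 * n) * E * P)) := by gcongr
    _ = 3 * saddleScale n * blockCount (2 * n) * P * (Real.exp (2 * n * saddlePoint n) * E) := by
        ring
    _ = 3 * saddleScale n * blockCount (2 * n) * P := by rw [h6, mul_one]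
    _ ≤ 3 * (100 * n) * blockCount (2 * n) * P := by gcongr
    _ = _ := by ring

end

/-- The region `P` of cells can be tiled by rectangles with block multiset `M`. -/
def TilesRegion (P : ℕ → ℕ → Prop) (M : Multiset (ℕ × ℕ)) : Prop :=
  ∃ T : Finset Rect, (∀ R ∈ T, R.1 < R.2.1 ∧ R.2.2.1 < R.2.2.2 ∧ ∀ i j, cellIn R i j → P i j) ∧
    (∀ i j, P i j → ∃ R ∈ T, cellIn R i j ∧ ∀ R' ∈ T, cellIn R' i j → R' = R) ∧ blocksOf T = M

lemma cellIn_corner {R : Rect} (h1 : R.1 < R.2.1) (h2 : R.2.2.1 < R.2.2.2) :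
    cellIn R R.1 R.2.2.1 :=
  ⟨le_rfl, h1, le_rfl, h2⟩

lemma TilesRegion.empty : TilesRegion (fun _ _ => False) 0 :=
  ⟨∅, by simp, by simp, by simp [blocksOf]⟩

lemma TilesRegion.single {R : Rect} (h1 : R.1 < R.2.1) (h2 : R.2.2.1 < R.2.2.2) :
    TilesRegion (cellIn R) {blockOf R} :=
  ⟨{R}, by simp [h1, h2], by simp, by simp [blocksOf]⟩

lemma TilesRegion.congr {P Q : ℕ → ℕ → Prop} {M : Multiset (ℕ × ℕ)} (h : TilesRegion P M)
    (hPQ : ∀ i j, P i j ↔ Q i j) : TilesRegion Q M := by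
  have : P = Q := by
    funext i j
    exact propext (hPQ i j)
  rwa [← this]

lemma TilesRegion.union {P Q : ℕ → ℕ → Prop} {M N : Multiset (ℕ × ℕ)} (hP : TilesRegion P M)
    (hQ : TilesRegion Q N) (hPQ : ∀ i j, P i j → ¬ Q i j) :
    TilesRegion (fun i j => P i j ∨ Q i j) (M + N) := by
  obtain ⟨T, hT1, hT2, rfl⟩ := hP
  obtain ⟨U, hU1, hU2, rfl⟩ := hQ
  have hd : Disjoint T U := by
    rw [Finset.disjoint_left]
    intro R hR hR'
    obtain ⟨h1, h2, h3⟩ := hT1 R hR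
    have hc := cellIn_corner h1 h2
    exact hPQ _ _ (h3 _ _ hc) ((hU1 R hR').2.2 _ _ hc)
  refine ⟨T.disjUnion U hd, ?_, ?_, ?_⟩
  · intro R hR
    rcases Finset.mem_disjUnion.1 hR with h | h
    · exact ⟨(hT1 R h).1, (hT1 R h).2.1, fun i j hc => Or.inl ((hT1 R h).2.2 i j hc)⟩
    · exact ⟨(hU1 R h).1, (hU1 R h).2.1, fun i j hc => Or.inr ((hU1 R h).2.2 i j hc)⟩
  · rintro i j (hp | hq)
    · obtain ⟨R, hR, hc, hu⟩ := hT2 i j hp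
      refine ⟨R, Finset.mem_disjUnion.2 (Or.inl hR), hc, fun R' hR' hc' => ?_⟩
      rcases Finset.mem_disjUnion.1 hR' with h | h
      · exact hu R' h hc'
      · exact absurd ((hU1 R' h).2.2 i j hc') (hPQ i j hp)
    · obtain ⟨R, hR, hc, hu⟩ := hU2 i j hq
      refine ⟨R, Finset.mem_disjUnion.2 (Or.inr hR), hc, fun R' hR' hc' => ?_⟩
      rcases Finset.mem_disjUnion.1 hR' with h | h
      · exact absurd hq (hPQ i j ((hT1 R' h).2.2 i j hc'))
      · exact hu R' h hc'
  · simp [blocksOf, Finset.disjUnion]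

/-- A strip is tiled by rectangles spanning its width. -/
lemma TilesRegion.strip {a b : ℕ} (hab : a < b) (l : Multiset ℕ) (hl : ∀ h ∈ l, 0 < h) (c : ℕ) :
    TilesRegion (cellIn (a, b, c, c + l.sum)) (l.map fun h => (min (b - a) h, max (b - a) h)) := by
  induction l using Multiset.induction generalizing c with
  | empty =>
    refine TilesRegion.congr TilesRegion.empty fun i j => ?_
    simp [cellIn]
  | cons h l ih =>
    have h0 := hl h (by simp)
    have h1 := TilesRegion.single (R := (a, b, c, c + h)) hab (by simpa using h0)
    have h2 := ih (fun k hk => hl k (by simp [hk])) (c + h)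
    have h3 := h1.union h2 (by
      intro i j
      simp only [cellIn]
      omega)
    rw [Multiset.map_cons, Multiset.sum_cons, ← Multiset.singleton_add]
    have h4 : blockOf (a, b, c, c + h) = (min (b - a) h, max (b - a) h) := by
      simp [blockOf]
    rw [h4] at h3
    refine h3.congr fun i j => ?_
    simp only [cellIn]
    omega

lemma TilesRegion.exists_isTiling {m n : ℕ} {M : Multiset (ℕ × ℕ)}
    (h : TilesRegion (cellIn (0, m, 0, n)) M) : ∃ T : Finset Rect, IsTiling m n T ∧ blocksOf T = M := by
  obtain ⟨T, h1, h2, h3⟩ := h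
  refine ⟨T, ⟨fun R hR => ?_, fun i hi j hj => ?_⟩, h3⟩
  · obtain ⟨h4, h5, h6⟩ := h1 R hR
    have h7 := h6 (R.2.1 - 1) (R.2.2.2 - 1) ⟨by omega, by omega, by omega, by omega⟩
    simp only [cellIn] at h7
    omega
  · obtain ⟨R, hR, hc, hu⟩ := h2 i j ⟨Nat.zero_le _, hi, Nat.zero_le _, hj⟩
    exact ⟨R, ⟨hR, hc⟩, fun R' hR' => hu R' hR'.1 hR'.2⟩

/-- A multiset of blocks whose unit-width blocks can be split evenly tiles a strip of width `2`. -/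
lemma exists_isTiling_two {n : ℕ} {A B C : Multiset ℕ} (hA : ∀ i ∈ A, 0 < i) (hB : ∀ i ∈ B, 0 < i)
    (hC : ∀ i ∈ C, 2 ≤ i) (hAB : A.sum = B.sum) (hn : A.sum + C.sum = n) :
    ∃ T : Finset Rect, IsTiling 2 n T ∧
      blocksOf T = (A + B).map (fun i => (1, i)) + C.map (fun i => (2, i)) := by
  have h1 := TilesRegion.strip (a := 0) (b := 1) one_pos A hA 0
  have h2 := TilesRegion.strip (a := 1) (b := 2) one_lt_two B hB 0
  have h3 := TilesRegion.strip (a := 0) (b := 2) two_pos C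
    (fun i hi => lt_of_lt_of_le two_pos (hC i hi)) A.sum
  have h4 := h1.union h2 (by intro i j; simp only [cellIn]; omega)
  have h5 := h4.union h3 (by intro i j; simp only [cellIn]; omega)
  have e : ∀ {k : ℕ} {D : Multiset ℕ}, (∀ i ∈ D, k ≤ i) →
      D.map (fun h => (min k h, max k h)) = D.map (fun i => (k, i)) := by
    intro k D hD
    refine Multiset.map_congr rfl fun i hi => ?_
    rw [min_eq_left (hD i hi), max_eq_right (hD i hi)]
  have h6 := h5.congr (Q := cellIn (0, 2, 0, n)) (by intro i j; simp only [cellIn]; omega)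
  obtain ⟨T, hT, hM⟩ := h6.exists_isTiling
  refine ⟨T, hT, ?_⟩
  rw [hM, Multiset.map_add, e (k := 1 - 0) hA, e (k := 2 - 1) hB, e (k := 2 - 0) hC]

lemma IsTiling.sum_area {m n : ℕ} {T : Finset Rect} (hT : IsTiling m n T) :
    ∑ R ∈ T, (R.2.1 - R.1) * (R.2.2.2 - R.2.2.1) = m * n := by
  have h : Finset.range m ×ˢ Finset.range n =
      T.biUnion fun R => Finset.Ico R.1 R.2.1 ×ˢ Finset.Ico R.2.2.1 R.2.2.2 := by
    ext ⟨i, j⟩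
    simp only [Finset.mem_product, Finset.mem_range, Finset.mem_biUnion, Finset.mem_Ico]
    constructor
    · rintro ⟨hi, hj⟩
      obtain ⟨R, ⟨hR, h1, h2, h3, h4⟩, -⟩ := hT.2 i hi j hj
      exact ⟨R, hR, ⟨h1, h2⟩, h3, h4⟩
    · rintro ⟨R, hR, h⟩
      have := hT.1 R hR
      omega
  have hc := congrArg Finset.card h
  rw [Finset.card_product, Finset.card_range, Finset.card_range, Finset.card_biUnion] at hc
  · rw [hc]
    refine Finset.sum_congr rfl fun R _ => ?_
    rw [Finset.card_product, Nat.card_Ico, Nat.card_Ico]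
  · intro R hR R' hR' hne
    refine Finset.disjoint_left.2 ?_
    rintro ⟨i, j⟩ h1 h2
    simp only [Finset.mem_product, Finset.mem_Ico] at h1 h2
    have h3 := hT.1 R hR
    obtain ⟨R₀, -, hu⟩ := hT.2 i (by omega) j (by omega)
    exact hne ((hu R ⟨hR, h1.1.1, h1.1.2, h1.2.1, h1.2.2⟩).trans
      (hu R' ⟨hR', h2.1.1, h2.1.2, h2.2.1, h2.2.2⟩).symm)

lemma blocksOf_mem_partSet {n : ℕ} {T : Finset Rect} (hT : IsTiling 2 n T) :
    blocksOf T ∈ partSet blockArea (blockParts (2 * n)) (2 * n) := by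
  constructor
  · intro b hb
    obtain ⟨R, hR, rfl⟩ := Multiset.mem_map.1 hb
    have := hT.1 R hR
    simp only [blockParts, blockOf, Finset.mem_union, Finset.mem_product, Finset.mem_singleton,
      Finset.mem_Icc]
    omega
  · rw [← hT.sum_area, totalWeight, blocksOf, Multiset.map_map]
    refine Finset.sum_congr rfl fun R _ => ?_
    simp [blockArea, blockOf, min_mul_max]

/-- The set of block multisets of tilings of a strip. -/
def tilingBlocks (n : ℕ) : Set (Multiset (ℕ × ℕ)) :=
  {M | ∃ T : Finset Rect, IsTiling 2 n T ∧ blocksOf T = M}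

lemma tilingBlocks_subset (n : ℕ) :
    tilingBlocks n ⊆ partSet blockArea (blockParts (2 * n)) (2 * n) := by
  rintro M ⟨T, hT, rfl⟩
  exact blocksOf_mem_partSet hT

lemma rectP_two_eq (n : ℕ) : rectP 2 n = (tilingBlocks n).ncard := rfl

lemma rectP_two_le (n : ℕ) : rectP 2 n ≤ blockCount (2 * n) :=
  Set.ncard_le_ncard (tilingBlocks_subset n) (partSet_finite _ _ blockArea_pos _)

/-- Greedy splitting of a multiset into two parts with a small difference of sums. -/
lemma exists_split_abs_le (M : Multiset ℕ) {z : ℕ} (hM : ∀ i ∈ M, i ≤ z) (d : ℤ) :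
    ∃ A B : Multiset ℕ, A + B = M ∧
      |d + A.sum - B.sum| ≤ max (z : ℤ) (|d| - M.sum) := by
  induction M using Multiset.induction generalizing d with
  | empty => exact ⟨0, 0, by simp, by simp⟩
  | cons i M ih =>
    have hi : (i : ℤ) ≤ z := by exact_mod_cast hM i (by simp)
    have hM' : ∀ k ∈ M, k ≤ z := fun k hk => hM k (by simp [hk])
    have hs : (0 : ℤ) ≤ (M.sum : ℤ) := Int.natCast_nonneg _
    have hi0 : (0 : ℤ) ≤ i := Int.natCast_nonneg _
    rcases le_total 0 d with hd | hd
    · obtain ⟨A, B, hAB, h⟩ := ih hM' (d - i)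
      refine ⟨A, i ::ₘ B, by rw [Multiset.add_cons, hAB], ?_⟩
      rw [Multiset.sum_cons, Multiset.sum_cons, Nat.cast_add, Nat.cast_add,
        show d + (A.sum : ℤ) - (i + B.sum) = d - i + A.sum - B.sum by ring]
      refine h.trans ?_
      rw [abs_of_nonneg hd]
      rcases abs_cases (d - i) with ⟨h1, -⟩ | ⟨h1, -⟩ <;> rw [h1] <;> omega
    · obtain ⟨A, B, hAB, h⟩ := ih hM' (d + i)
      refine ⟨i ::ₘ A, B, by rw [Multiset.cons_add, hAB], ?_⟩
      rw [Multiset.sum_cons, Multiset.sum_cons, Nat.cast_add, Nat.cast_add,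
        show d + ((i : ℤ) + A.sum) - B.sum = d + i + A.sum - B.sum by ring]
      refine h.trans ?_
      rw [abs_of_nonpos hd]
      rcases abs_cases (d + i) with ⟨h1, -⟩ | ⟨h1, -⟩ <;> rw [h1] <;> omega

lemma exists_balanced_split {M : Multiset ℕ} {z L : ℕ} (heven : Even M.sum) (hL : ∀ i ∈ M, i ≤ L)
    (hone : z ≤ M.count 1) (hmid : L ≤ (M.filter fun i => i ≠ 1 ∧ i ≤ z).sum) :
    ∃ A B : Multiset ℕ, A + B = M ∧ A.sum = B.sum := by
  set M₁ := M.filter (fun i => i = 1) with hM₁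
  set M₂ := M.filter (fun i => i ≠ 1 ∧ i ≤ z) with hM₂
  set M₃ := M.filter (fun i => i ≠ 1 ∧ ¬ i ≤ z) with hM₃
  have hM : M₃ + M₂ + M₁ = M := by
    have h1 := Multiset.filter_add_not (fun i => i = 1) M
    have h2 := Multiset.filter_add_not (fun i => i ≤ z) (M.filter (fun i => ¬ i = 1))
    rw [Multiset.filter_filter, Multiset.filter_filter] at h2
    rw [← h2] at h1
    rw [← h1, hM₁, hM₂, hM₃, add_comm]
    congr 1
    rw [add_comm]
    simp only [and_comm, ne_eq]
  have hs₁ : M₁.sum = M.count 1 := by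
    rw [hM₁, Multiset.filter_eq', Multiset.sum_replicate, smul_eq_mul, mul_one]
  obtain ⟨A₃, B₃, h₃, hd₃⟩ := exists_split_abs_le M₃ (z := L)
    (fun i hi => hL i (Multiset.mem_of_mem_filter hi)) 0
  obtain ⟨A₂, B₂, h₂, hd₂⟩ := exists_split_abs_le M₂ (z := z)
    (fun i hi => (Multiset.of_mem_filter hi).2) (0 + A₃.sum - B₃.sum)
  obtain ⟨A₁, B₁, h₁, hd₁⟩ := exists_split_abs_le M₁ (z := 1)
    (fun i hi => (Multiset.of_mem_filter hi).le) (0 + A₃.sum - B₃.sum + A₂.sum - B₂.sum)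
  refine ⟨A₃ + A₂ + A₁, B₃ + B₂ + B₁, ?_, ?_⟩
  · rw [← hM, ← h₁, ← h₂, ← h₃]
    abel
  · have e : M.sum = A₃.sum + B₃.sum + (A₂.sum + B₂.sum) + (A₁.sum + B₁.sum) := by
      rw [← hM, ← h₁, ← h₂, ← h₃]
      simp only [Multiset.sum_add]
    rw [e] at heven
    obtain ⟨k, hk⟩ := heven
    simp only [Multiset.sum_add]
    rw [abs_zero] at hd₃
    have h4 : |0 + (A₃.sum : ℤ) - B₃.sum + A₂.sum - B₂.sum + A₁.sum - B₁.sum| ≤ 1 := by omega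
    rw [abs_le] at h4
    omega

/-- The lengths of the blocks of width `1`. -/
def unitLengths (M : Multiset (ℕ × ℕ)) : Multiset ℕ :=
  (M.filter fun b => b.1 = 1).map Prod.snd

lemma mem_unitLengths {M : Multiset (ℕ × ℕ)} {i : ℕ} : i ∈ unitLengths M ↔ (1, i) ∈ M := by
  simp only [unitLengths, Multiset.mem_map, Multiset.mem_filter]
  constructor
  · rintro ⟨⟨a, c⟩, ⟨h1, h2⟩, h3⟩
    simp only at h2 h3
    rwa [← h2, ← h3]
  · exact fun h => ⟨(1, i), ⟨h, rfl⟩, rfl⟩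

lemma mem_blockParts {K i j : ℕ} : (i, j) ∈ blockParts K ↔
    (i = 1 ∧ 1 ≤ j ∧ j ≤ K) ∨ (i = 2 ∧ 2 ≤ j ∧ j ≤ K) := by
  simp only [blockParts, Finset.mem_union, Finset.mem_product, Finset.mem_singleton,
    Finset.mem_Icc]

lemma mem_tilingBlocks_of_balanced {n z L : ℕ} {M : Multiset (ℕ × ℕ)}
    (hM : M ∈ partSet blockArea (blockParts (2 * n)) (2 * n)) (hone : z ≤ M.count (1, 1))
    (hL : ∀ i, (1, i) ∈ M → i ≤ L)
    (hmid : L ≤ ((unitLengths M).filter fun i => i ≠ 1 ∧ i ≤ z).sum) : M ∈ tilingBlocks n := by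
  set C := (M.filter fun b => ¬ b.1 = 1).map Prod.snd with hC
  have hdec : (unitLengths M).map (fun i => (1, i)) + C.map (fun i => (2, i)) = M := by
    conv_rhs => rw [← Multiset.filter_add_not (fun b : ℕ × ℕ => b.1 = 1) M]
    rw [unitLengths, hC, Multiset.map_map, Multiset.map_map]
    congr 1
    · conv_rhs => rw [← Multiset.map_id (M.filter fun b => b.1 = 1)]
      refine Multiset.map_congr rfl fun b hb => ?_
      exact Prod.ext (Multiset.of_mem_filter hb).symm rfl
    · conv_rhs => rw [← Multiset.map_id (M.filter fun b => ¬ b.1 = 1)]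
      refine Multiset.map_congr rfl fun b hb => ?_
      have h1 := hM.1 b (Multiset.mem_of_mem_filter hb)
      have h2 := Multiset.of_mem_filter hb
      obtain ⟨i, j⟩ := b
      rw [mem_blockParts] at h1
      refine Prod.ext ?_ rfl
      simp only [Function.comp_apply, id] at *
      omega
  have hsum : (unitLengths M).sum + 2 * C.sum = 2 * n := by
    have := hM.2
    rw [← hdec, totalWeight_add, totalWeight, totalWeight, Multiset.map_map, Multiset.map_map] at this
    have h2 : (C.map fun i => 2 * i).sum = 2 * C.sum := by
      simpa using Multiset.sum_map_mul_left (s := C) (a := 2) (f := id)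
    simpa [blockArea, Function.comp_def, h2] using this
  have hcount : z ≤ (unitLengths M).count 1 := by
    rw [Multiset.le_count_iff_replicate_le] at hone ⊢
    have h1 := Multiset.map_le_map (f := Prod.snd)
      (Multiset.filter_le_filter (fun b : ℕ × ℕ => b.1 = 1) hone)
    rwa [Multiset.filter_eq_self.2 (by
      intro b hb
      rw [Multiset.eq_of_mem_replicate hb]), Multiset.map_replicate] at h1
  obtain ⟨A, B, hAB, hs⟩ := exists_balanced_split (M := unitLengths M) (z := z) (L := L)
    ⟨n - C.sum, by omega⟩ (fun i hi => hL i (mem_unitLengths.1 hi)) hcount hmid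
  have hpos : ∀ i ∈ unitLengths M, 0 < i := by
    intro i hi
    have := hM.1 _ (mem_unitLengths.1 hi)
    rw [mem_blockParts] at this
    omega
  have hC2 : ∀ i ∈ C, 2 ≤ i := by
    intro i hi
    obtain ⟨⟨a, c⟩, hb, rfl⟩ := Multiset.mem_map.1 hi
    have h1 := hM.1 _ (Multiset.mem_of_mem_filter hb)
    have h2 := Multiset.of_mem_filter hb
    rw [mem_blockParts] at h1
    simp only at *
    omega
  have hAB' : A.sum + B.sum = (unitLengths M).sum := by rw [← hAB, Multiset.sum_add]
  obtain ⟨T, hT, hbl⟩ := exists_isTiling_two (n := n) (C := C)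
    (fun i hi => hpos i (by rw [← hAB]; exact Multiset.mem_add.2 (Or.inl hi)))
    (fun i hi => hpos i (by rw [← hAB]; exact Multiset.mem_add.2 (Or.inr hi))) hC2 hs (by omega)
  exact ⟨T, hT, by rw [hbl, hAB, hdec]⟩

lemma ncard_count_lt_add_le {n z : ℕ} (hz : z ≤ 2 * n) :
    {M ∈ partSet blockArea (blockParts (2 * n)) (2 * n) | M.count (1, 1) < z}.ncard +
      blockCount (2 * n - z) ≤ blockCount (2 * n) := by
  have hfin := partSet_finite blockArea (blockParts (2 * n)) blockArea_pos (2 * n)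
  set X := partSet blockArea (blockParts (2 * n)) (2 * n)
  set Y := partSet blockArea (blockParts (2 * n)) (2 * n - z) with hY
  have h1 : blockCount (2 * n - z) = ((fun M => Multiset.replicate z (1, 1) + M) '' Y).ncard := by
    rw [Set.ncard_image_of_injective _ (add_right_injective _), hY,
      partSet_blockParts_eq (show 2 * n - z ≤ 2 * n by omega), blockCount]
  have hsub : (fun M => Multiset.replicate z (1, 1) + M) '' Y ⊆ X := by
    rintro _ ⟨M, hM, rfl⟩
    refine ⟨fun b hb => ?_, ?_⟩
    · rcases Multiset.mem_add.1 hb with h | h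
      · have hz0 : z ≠ 0 := by
          rintro rfl
          simp at h
        rw [Multiset.eq_of_mem_replicate h, mem_blockParts]
        omega
      · exact hM.1 b h
    · simp only [totalWeight_add, totalWeight_replicate, hM.2, blockArea]
      omega
  rw [h1, blockCount, ← Set.ncard_union_eq ?_ (hfin.subset (Set.sep_subset _ _)) (hfin.subset hsub)]
  · exact Set.ncard_le_ncard (Set.union_subset (Set.sep_subset _ _) hsub) hfin
  · rw [Set.disjoint_left]
    rintro _ ⟨-, h⟩ ⟨M, -, rfl⟩
    simp at h

lemma ncard_exists_long_le (n L : ℕ) :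
    {M ∈ partSet blockArea (blockParts (2 * n)) (2 * n) | ∃ i, L < i ∧ (1, i) ∈ M}.ncard ≤
      ∑ i ∈ Finset.Ioc L (2 * n), blockCount (2 * n - i) := by
  have hfin := partSet_finite blockArea (blockParts (2 * n)) blockArea_pos (2 * n)
  have hsub : {M ∈ partSet blockArea (blockParts (2 * n)) (2 * n) | ∃ i, L < i ∧ (1, i) ∈ M} ⊆
      ⋃ i ∈ Finset.Ioc L (2 * n), (fun M => ((1, i) : ℕ × ℕ) ::ₘ M) ''
        partSet blockArea (blockParts (2 * n)) (2 * n - i) := by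
    rintro M ⟨hM, i, hi, hiM⟩
    have hi2 := hM.1 _ hiM
    rw [mem_blockParts] at hi2
    simp only [Set.mem_iUnion, Finset.mem_Ioc]
    obtain ⟨M', rfl⟩ := Multiset.exists_cons_of_mem hiM
    refine ⟨i, ⟨hi, by omega⟩, M', ⟨fun b hb => hM.1 b (Multiset.mem_cons_of_mem hb), ?_⟩, rfl⟩
    have := hM.2
    simp only [totalWeight, Multiset.map_cons, Multiset.sum_cons, blockArea] at this ⊢
    omega
  have hf : ∀ i, (partSet blockArea (blockParts (2 * n)) (2 * n - i)).Finite := fun i =>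
    partSet_finite _ _ blockArea_pos _
  refine (Set.ncard_le_ncard hsub (Set.Finite.biUnion (Finset.finite_toSet _)
    fun i _ => (hf i).image _)).trans ?_
  refine (Finset.set_ncard_biUnion_le _ _).trans (Finset.sum_le_sum fun i _ => ?_)
  refine (Set.ncard_image_le (hf i)).trans ?_
  rw [partSet_blockParts_eq (show 2 * n - i ≤ 2 * n by omega), blockCount]

/-- The blocks of width `1` with length in a window. -/
def blockWindow (y l q : ℕ) : Finset (ℕ × ℕ) :=
  {1} ×ˢ Finset.Ico (y + q * l) (y + (q + 1) * l)

lemma mul_le_sum_filter_of_forall_window {M : Multiset (ℕ × ℕ)} {y l Q : ℕ} (hy : 2 ≤ y)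
    (h : ∀ q < Q, ∃ b ∈ blockWindow y l q, b ∈ M) :
    Q * y ≤ ((unitLengths M).filter fun i => i ≠ 1 ∧ i ≤ y + Q * l).sum := by
  have h' : ∀ q : Fin Q, ∃ i, y + q * l ≤ i ∧ i < y + (q + 1) * l ∧ (1, i) ∈ M := by
    intro q
    obtain ⟨⟨a, i⟩, hb, hM⟩ := h q q.2
    simp only [blockWindow, Finset.mem_product, Finset.mem_singleton, Finset.mem_Ico] at hb
    obtain ⟨rfl, h1, h2⟩ := hb
    exact ⟨i, h1, h2, hM⟩
  choose f hf1 hf2 hf3 using h'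
  have hinj : Function.Injective f := by
    have : StrictMono f := by
      intro p q hpq
      have h1 : ((p : ℕ) + 1) * l ≤ q * l := Nat.mul_le_mul_right _ hpq
      have := hf1 q
      have := hf2 p
      omega
    exact this.injective
  have hle : (Finset.univ.map ⟨f, hinj⟩).val ≤
      (unitLengths M).filter fun i => i ≠ 1 ∧ i ≤ y + Q * l := by
    rw [Multiset.le_iff_subset (Finset.nodup _)]
    intro i hi
    simp only [Finset.mem_val, Finset.mem_map, Finset.mem_univ, true_and,
      Function.Embedding.coeFn_mk] at hi
    obtain ⟨q, rfl⟩ := hi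
    rw [Multiset.mem_filter, mem_unitLengths]
    have h1 : ((q : ℕ) + 1) * l ≤ Q * l := Nat.mul_le_mul_right _ q.2
    have := hf1 q
    have := hf2 q
    exact ⟨hf3 q, by omega, by omega⟩
  obtain ⟨U, hU⟩ := Multiset.le_iff_exists_add.1 hle
  rw [hU, Multiset.sum_add]
  refine le_add_right ?_
  have : (Finset.univ.map ⟨f, hinj⟩).val.sum = ∑ q, f q := by
    rw [Finset.map_val]
    rfl
  rw [this]
  calc Q * y = ∑ _q : Fin Q, y := by simp
    _ ≤ _ := Finset.sum_le_sum fun q _ => (Nat.le_add_right _ _).trans (hf1 q)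

lemma ncard_sum_filter_lt_le {n y l Q L z : ℕ} (hy : 2 ≤ y) (hL : L ≤ Q * y) (hz : z = y + Q * l) :
    {M ∈ partSet blockArea (blockParts (2 * n)) (2 * n) |
      ((unitLengths M).filter fun i => i ≠ 1 ∧ i ≤ z).sum < L}.ncard ≤
      ∑ q ∈ Finset.range Q,
        (partSet blockArea (blockParts (4 * n) \ blockWindow y l q) (2 * n)).ncard := by
  have hf : ∀ q, (partSet blockArea (blockParts (4 * n) \ blockWindow y l q) (2 * n)).Finite :=
    fun q => partSet_finite _ _ (fun b hb => blockArea_pos b (Finset.mem_sdiff.1 hb).1) _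
  refine (Set.ncard_le_ncard (t := ⋃ q ∈ Finset.range Q,
    partSet blockArea (blockParts (4 * n) \ blockWindow y l q) (2 * n)) ?_
    (Set.Finite.biUnion (Finset.finite_toSet _) fun q _ => hf q)).trans
    (Finset.set_ncard_biUnion_le _ _)
  rintro M ⟨hM, hlt⟩
  by_contra hc
  simp only [Set.mem_iUnion, Finset.mem_range, not_exists] at hc
  subst hz
  refine absurd (mul_le_sum_filter_of_forall_window (M := M) (l := l) hy fun q hq => ?_)
    (not_le.2 (hlt.trans_le hL))
  by_contra hno
  push Not at hno
  rw [← partSet_blockParts_eq (show 2 * n ≤ 4 * n by omega)] at hM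
  exact hc q hq ⟨fun b hb => Finset.mem_sdiff.2 ⟨hM.1 b hb, fun hw => hno b hw hb⟩, hM.2⟩

/-- Upper bound for the number of block multisets that are not realised by a tiling. -/
lemma blockCount_le_rectP_add {n y l Q L z : ℕ} (hz2 : z ≤ 2 * n) (hy : 2 ≤ y) (hL : L ≤ Q * y)
    (hz : z = y + Q * l) :
    blockCount (2 * n - z) ≤ rectP 2 n + ∑ i ∈ Finset.Ioc L (2 * n), blockCount (2 * n - i) +
      ∑ q ∈ Finset.range Q,
        (partSet blockArea (blockParts (4 * n) \ blockWindow y l q) (2 * n)).ncard := by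
  have hfin := partSet_finite blockArea (blockParts (2 * n)) blockArea_pos (2 * n)
  have h1 := ncard_count_lt_add_le hz2
  have h2 := ncard_exists_long_le n L
  have h3 := ncard_sum_filter_lt_le (n := n) hy hL hz
  set X := partSet blockArea (blockParts (2 * n)) (2 * n) with hX
  set X₁ := {M ∈ X | M.count (1, 1) < z}
  set X₂ := {M ∈ X | ∃ i, L < i ∧ (1, i) ∈ M}
  set X₃ := {M ∈ X | ((unitLengths M).filter fun i => i ≠ 1 ∧ i ≤ z).sum < L}
  have hcov : X ⊆ tilingBlocks n ∪ X₁ ∪ X₂ ∪ X₃ := by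
    intro M hM
    by_contra hc
    simp only [Set.mem_union, not_or] at hc
    obtain ⟨⟨⟨hT, h₁⟩, h₂⟩, h₃⟩ := hc
    refine hT (mem_tilingBlocks_of_balanced (z := z) (L := L) hM ?_ ?_ ?_)
    · by_contra h
      exact h₁ ⟨hM, not_le.1 h⟩
    · intro i hi
      by_contra h
      exact h₂ ⟨hM, i, not_le.1 h, hi⟩
    · by_contra h
      exact h₃ ⟨hM, not_le.1 h⟩
  have h4 : blockCount (2 * n) ≤ (tilingBlocks n ∪ X₁ ∪ X₂ ∪ X₃).ncard :=
    Set.ncard_le_ncard hcov ((((hfin.subset (tilingBlocks_subset n)).union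
      (hfin.subset (Set.sep_subset _ _))).union (hfin.subset (Set.sep_subset _ _))).union
      (hfin.subset (Set.sep_subset _ _)))
  have h5 := Set.ncard_union_le (tilingBlocks n ∪ X₁ ∪ X₂) X₃
  have h6 := Set.ncard_union_le (tilingBlocks n ∪ X₁) X₂
  have h7 := Set.ncard_union_le (tilingBlocks n) X₁
  rw [rectP_two_eq]
  omega

section

open Filter Topology

lemma ncard_partSet_le_exp_mul {ι : Type*} [DecidableEq ι] (w : ι → ℕ) (S : Finset ι)
    (hS : ∀ b ∈ S, 0 < w b) (k : ℕ) {t : ℝ} (ht : 0 < t) :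
    ((partSet w S k).ncard : ℝ) ≤
      Real.exp (k * t) * ∏ b ∈ S, (1 - Real.exp (-(t * w b)))⁻¹ := by
  have h := ncard_partSet_mul_pow_le w S hS k (Real.exp_pos (-t))
    (Real.exp_lt_one_iff.2 (by linarith))
  have hpow : ∀ m : ℕ, Real.exp (-t) ^ m = Real.exp (-(t * m)) := by
    intro m
    rw [← Real.exp_nat_mul]
    congr 1
    ring
  simp only [hpow] at h
  rw [mul_comm (Real.exp (k * t))]
  rwa [Real.exp_neg, mul_inv_le_iff₀ (Real.exp_pos _), mul_comm t] at h

/-- The natural scale for the number of block multisets. -/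
noncomputable def blockBound (n : ℕ) : ℝ :=
  Real.exp (2 * n * saddlePoint n) *
    ∏ b ∈ blockParts (4 * n), (1 - Real.exp (-(saddlePoint n * blockArea b)))⁻¹

lemma blockBound_pos (n : ℕ) : 0 < blockBound n := by
  have := prod_one_sub_exp_pos n
  rw [blockBound, Finset.prod_inv_distrib]
  positivity

lemma blockCount_sub_le {n i : ℕ} (hi : i ≤ 2 * n) :
    (blockCount (2 * n - i) : ℝ) ≤ blockBound n * Real.exp (-(saddlePoint n * i)) := by
  have h := ncard_partSet_le_exp_mul blockArea (blockParts (4 * n)) blockArea_pos (2 * n - i)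
    (saddlePoint_pos n)
  rw [partSet_blockParts_eq (show 2 * n - i ≤ 4 * n by omega)] at h
  refine h.trans (le_of_eq ?_)
  rw [blockBound, mul_right_comm, ← Real.exp_add, Nat.cast_sub hi]
  congr 2
  push_cast
  ring

lemma ncard_partSet_sdiff_le {n y l q z : ℕ} (hy : 1 ≤ y) (hz : y + (q + 1) * l ≤ z)
    (hz4 : z ≤ 4 * n) :
    ((partSet blockArea (blockParts (4 * n) \ blockWindow y l q) (2 * n)).ncard : ℝ) ≤
      blockBound n * (saddlePoint n * z) ^ l := by
  have ht := saddlePoint_pos n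
  have hsub : blockWindow y l q ⊆ blockParts (4 * n) := by
    rintro ⟨a, i⟩ hb
    simp only [blockWindow, Finset.mem_product, Finset.mem_singleton, Finset.mem_Ico] at hb
    rw [mem_blockParts]
    omega
  have hcard : (blockWindow y l q).card = l := by
    rw [blockWindow, Finset.card_product, Finset.card_singleton, Nat.card_Ico, add_mul]
    omega
  have h := ncard_partSet_le_exp_mul blockArea (blockParts (4 * n) \ blockWindow y l q)
    (fun b hb => blockArea_pos b (Finset.mem_sdiff.1 hb).1) (2 * n) ht
  have hpos : ∀ b ∈ blockParts (4 * n), 0 < 1 - Real.exp (-(saddlePoint n * blockArea b)) :=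
    fun b hb => sub_pos.2 (exp_neg_mul_lt_one ht (blockArea_pos b hb))
  have hprod : ∏ b ∈ blockParts (4 * n) \ blockWindow y l q,
      (1 - Real.exp (-(saddlePoint n * blockArea b)))⁻¹ =
      (∏ b ∈ blockParts (4 * n), (1 - Real.exp (-(saddlePoint n * blockArea b)))⁻¹) *
      ∏ b ∈ blockWindow y l q, (1 - Real.exp (-(saddlePoint n * blockArea b))) := by
    rw [← Finset.prod_sdiff hsub, mul_assoc, ← Finset.prod_mul_distrib,
      Finset.prod_eq_one (s := blockWindow y l q), mul_one]
    intro b hb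
    exact inv_mul_cancel₀ (hpos b (hsub hb)).ne'
  have hle : ∏ b ∈ blockWindow y l q, (1 - Real.exp (-(saddlePoint n * blockArea b))) ≤
      (saddlePoint n * z) ^ l := by
    calc _ ≤ ∏ _b ∈ blockWindow y l q, saddlePoint n * z :=
          Finset.prod_le_prod (fun b hb => (hpos b (hsub hb)).le) fun b hb => ?_
      _ = _ := by rw [Finset.prod_const, hcard]
    have harea : (blockArea b : ℝ) ≤ z := by
      obtain ⟨a, i⟩ := b
      simp only [blockWindow, Finset.mem_product, Finset.mem_singleton, Finset.mem_Ico] at hb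
      obtain ⟨rfl, hi⟩ := hb
      simp only [blockArea, one_mul]
      exact_mod_cast hi.2.le.trans hz
    have := Real.add_one_le_exp (-(saddlePoint n * blockArea b))
    have := mul_le_mul_of_nonneg_left harea ht.le
    linarith
  rw [hprod, ← mul_assoc] at h
  push_cast at h
  refine h.trans ?_
  rw [blockBound]
  exact mul_le_mul_of_nonneg_left hle (blockBound_pos n).le

/-- An integer approximation of the eighth root. -/
def eighthRoot (n : ℕ) : ℕ := Nat.sqrt (Nat.sqrt (Nat.sqrt n))

lemma eighthRoot_pow_le (n : ℕ) : (eighthRoot n : ℝ) ^ 4 ≤ √n := by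
  refine Real.le_sqrt_of_sq_le ?_
  have h1 : eighthRoot n ^ 2 ≤ Nat.sqrt (Nat.sqrt n) := Nat.sqrt_le' _
  have h2 : Nat.sqrt (Nat.sqrt n) ^ 2 ≤ Nat.sqrt n := Nat.sqrt_le' _
  have h3 : Nat.sqrt n ^ 2 ≤ n := Nat.sqrt_le' _
  have h : (eighthRoot n ^ 4) ^ 2 ≤ n := by
    calc (eighthRoot n ^ 4) ^ 2 = ((eighthRoot n ^ 2) ^ 2) ^ 2 := by ring
      _ ≤ (Nat.sqrt (Nat.sqrt n) ^ 2) ^ 2 := by gcongr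
      _ ≤ Nat.sqrt n ^ 2 := by gcongr
      _ ≤ n := h3
  exact_mod_cast h

lemma sqrt_le_eighthRoot_add_one_pow (n : ℕ) : √(n : ℝ) ≤ ((eighthRoot n : ℝ) + 1) ^ 4 := by
  rw [Real.sqrt_le_left (by positivity)]
  have h1 : Nat.sqrt (Nat.sqrt n) < (eighthRoot n + 1) ^ 2 := Nat.lt_succ_sqrt' _
  have h2 : Nat.sqrt n < (Nat.sqrt (Nat.sqrt n) + 1) ^ 2 := Nat.lt_succ_sqrt' _
  have h3 : n < (Nat.sqrt n + 1) ^ 2 := Nat.lt_succ_sqrt' _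
  have h : n ≤ ((eighthRoot n + 1) ^ 4) ^ 2 := by
    calc n ≤ (Nat.sqrt n + 1) ^ 2 := h3.le
      _ ≤ ((Nat.sqrt (Nat.sqrt n) + 1) ^ 2) ^ 2 := by gcongr; omega
      _ ≤ (((eighthRoot n + 1) ^ 2) ^ 2) ^ 2 := by gcongr; omega
      _ = _ := by ring
  exact_mod_cast h

lemma tendsto_eighthRoot : Tendsto eighthRoot atTop atTop := by
  have h : Tendsto Nat.sqrt atTop atTop := by
    refine tendsto_atTop_atTop.2 fun b => ⟨b ^ 2, fun a ha => ?_⟩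
    exact Nat.le_sqrt'.2 ha
  exact h.comp (h.comp h)

lemma eventually_eighthRoot_bounds : ∀ᶠ n : ℕ in atTop, 256 ≤ n ∧ 16 ≤ eighthRoot n ∧
    saddlePoint n * (2 * eighthRoot n ^ 3 : ℕ) ≤ 8 / eighthRoot n ∧
    (eighthRoot n : ℝ) / 64 ≤ saddlePoint n * (eighthRoot n ^ 5 : ℕ) ∧
    (n : ℝ) ≤ 256 * eighthRoot n ^ 8 ∧ 2 * (eighthRoot n : ℝ) ^ 3 ≤ 2 * √n ∧
    2 * eighthRoot n ^ 3 ≤ 2 * n := by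
  filter_upwards [eventually_ge_atTop 256, tendsto_eighthRoot.eventually_ge_atTop 16] with n hn hs
  have hs' : (16 : ℝ) ≤ eighthRoot n := by exact_mod_cast hs
  have h1 := eighthRoot_pow_le n
  have h2 : √(n : ℝ) ≤ 16 * eighthRoot n ^ 4 := by
    refine (sqrt_le_eighthRoot_add_one_pow n).trans ?_
    calc ((eighthRoot n : ℝ) + 1) ^ 4 ≤ (2 * eighthRoot n) ^ 4 := by gcongr; linarith
      _ = _ := by ring
  have h3 : √(n : ℝ) ^ 2 = n := Real.sq_sqrt (Nat.cast_nonneg n)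
  have h4 := saddlePoint_spec hn
  have h5 := sixteen_le_sqrt hn
  have h6 : (eighthRoot n : ℝ) ^ 3 ≤ eighthRoot n ^ 4 := pow_le_pow_right₀ (by linarith) (by norm_num)
  have h7 : 2 * (eighthRoot n : ℝ) ^ 3 ≤ 2 * √n := by linarith
  refine ⟨hn, hs, ?_, ?_, ?_, h7, ?_⟩
  · push_cast
    calc saddlePoint n * (2 * (eighthRoot n : ℝ) ^ 3) ≤ 4 / √n * (2 * (eighthRoot n : ℝ) ^ 3) := by
          gcongr; exact h4.2.1
      _ ≤ 4 / (eighthRoot n : ℝ) ^ 4 * (2 * (eighthRoot n : ℝ) ^ 3) := by gcongr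
      _ = _ := by field_simp; norm_num
  · push_cast
    calc (eighthRoot n : ℝ) / 64 = 1 / (4 * (16 * (eighthRoot n : ℝ) ^ 4)) * eighthRoot n ^ 5 := by
          field_simp; norm_num
      _ ≤ 1 / (4 * √n) * eighthRoot n ^ 5 := by gcongr
      _ ≤ _ := by gcongr; exact h4.1
  · rw [← h3]
    calc √(n : ℝ) ^ 2 ≤ (16 * (eighthRoot n : ℝ) ^ 4) ^ 2 := by gcongr
      _ = _ := by ring
  · have : (2 * eighthRoot n ^ 3 : ℝ) ≤ 2 * n := by nlinarith
    exact_mod_cast this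

lemma tendsto_blockCount_sub_div :
    Tendsto (fun n => (blockCount (2 * n - 2 * eighthRoot n ^ 3) : ℝ) / blockCount (2 * n))
      atTop (𝓝 1) := by
  have h := tendsto_blockCount_div (κ := fun n => 2 * n - 2 * eighthRoot n ^ 3) (C := 2) (by
    filter_upwards [eventually_eighthRoot_bounds] with n hn
    rw [Nat.cast_sub hn.2.2.2.2.2.2]
    push_cast
    rw [abs_sub_comm, sub_sub_cancel, abs_of_nonneg (by positivity)]
    exact hn.2.2.2.2.2.1)
  have hs : Tendsto (fun n => (8 : ℝ) / eighthRoot n) atTop (𝓝 0) :=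
    (tendsto_natCast_atTop_atTop.comp tendsto_eighthRoot).const_div_atTop 8
  have ht : Tendsto (fun n => saddlePoint n * (2 * eighthRoot n ^ 3 : ℕ)) atTop (𝓝 0) := by
    refine squeeze_zero' (Eventually.of_forall fun n => ?_) ?_ hs
    · have := saddlePoint_pos n
      positivity
    · filter_upwards [eventually_eighthRoot_bounds] with n hn using hn.2.2.1
  have hexp := (Real.continuous_exp.tendsto 0).comp ht
  rw [Real.exp_zero] at hexp
  have h2 := h.div hexp one_ne_zero
  rw [div_one] at h2
  refine h2.congr' ?_
  filter_upwards [eventually_eighthRoot_bounds] with n hn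
  simp only [Pi.div_apply, Function.comp_apply]
  rw [Nat.cast_sub hn.2.2.2.2.2.2]
  have : -(saddlePoint n * (((2 * n : ℕ) : ℝ) - ((2 * eighthRoot n ^ 3 : ℕ) : ℝ) - 2 * n)) =
      saddlePoint n * (2 * eighthRoot n ^ 3 : ℕ) := by
    push_cast
    ring
  rw [this]
  field_simp

lemma eventually_blockCount_div_le : ∀ᶠ n : ℕ in atTop,
    (blockCount (2 * n - 2 * eighthRoot n ^ 3) : ℝ) / blockCount (2 * n) -
      (600 * 256 ^ 2 * eighthRoot n ^ 16 * Real.exp (-(eighthRoot n / 64)) +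
        300 * 256 * ((eighthRoot n : ℝ) ^ 10 * (1 / 2) ^ eighthRoot n)) ≤
      rectP 2 n / blockCount (2 * n) := by
  filter_upwards [eventually_eighthRoot_bounds, eventually_exp_mul_prod_le] with n hn hG
  obtain ⟨hn, hs, h1, h2, h3, -, h5⟩ := hn
  set s := eighthRoot n with hs_def
  have ht := saddlePoint_pos n
  have hg : (0 : ℝ) < blockCount (2 * n) := by exact_mod_cast blockCount_pos (by omega)
  have hs' : (16 : ℝ) ≤ s := by exact_mod_cast hs
  have hz : 2 * s ^ 3 = s ^ 3 + s ^ 2 * s := by ring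
  have hy : 2 ≤ s ^ 3 := by
    calc 2 ≤ s := by omega
      _ ≤ s ^ 3 := Nat.le_self_pow (by norm_num) s
  have hmain := blockCount_le_rectP_add (n := n) (y := s ^ 3) (l := s) (Q := s ^ 2) (L := s ^ 5)
    h5 hy (by rw [← pow_add]) hz
  have hlong : ((∑ i ∈ Finset.Ioc (s ^ 5) (2 * n), blockCount (2 * n - i) : ℕ) : ℝ) ≤
      600 * 256 ^ 2 * s ^ 16 * Real.exp (-(s / 64)) * blockCount (2 * n) := by
    push_cast
    have hterm : ∀ i ∈ Finset.Ioc (s ^ 5) (2 * n), (blockCount (2 * n - i) : ℝ) ≤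
        300 * n * blockCount (2 * n) * Real.exp (-(s / 64)) := by
      intro i hi
      rw [Finset.mem_Ioc] at hi
      refine (blockCount_sub_le hi.2).trans ?_
      have : (s : ℝ) / 64 ≤ saddlePoint n * i :=
        h2.trans (by gcongr; exact hi.1.le)
      gcongr
      exact hG
    refine (Finset.sum_le_card_nsmul _ _ _ hterm).trans ?_
    rw [nsmul_eq_mul, Nat.card_Ioc]
    calc ((2 * n - s ^ 5 : ℕ) : ℝ) * (300 * n * blockCount (2 * n) * Real.exp (-(s / 64)))
        ≤ (2 * n : ℕ) * (300 * n * blockCount (2 * n) * Real.exp (-(s / 64))) := by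
          gcongr
          exact Nat.sub_le _ _
      _ = 600 * (n : ℝ) ^ 2 * Real.exp (-(s / 64)) * blockCount (2 * n) := by push_cast; ring
      _ ≤ 600 * (256 * s ^ 8) ^ 2 * Real.exp (-(s / 64)) * blockCount (2 * n) := by gcongr
      _ = _ := by ring
  have hmid : ((∑ q ∈ Finset.range (s ^ 2), (partSet blockArea (blockParts (4 * n) \
      blockWindow (s ^ 3) s q) (2 * n)).ncard : ℕ) : ℝ) ≤
      300 * 256 * ((s : ℝ) ^ 10 * (1 / 2) ^ s) * blockCount (2 * n) := by
    push_cast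
    have hterm : ∀ q ∈ Finset.range (s ^ 2), ((partSet blockArea (blockParts (4 * n) \
        blockWindow (s ^ 3) s q) (2 * n)).ncard : ℝ) ≤
        300 * n * blockCount (2 * n) * (1 / 2) ^ s := by
      intro q hq
      rw [Finset.mem_range] at hq
      have hq' : (q + 1) * s ≤ s ^ 2 * s := Nat.mul_le_mul_right _ hq
      refine (ncard_partSet_sdiff_le (z := 2 * s ^ 3) (by omega) (by omega) (by omega)).trans ?_
      have : saddlePoint n * ((2 * s ^ 3 : ℕ) : ℝ) ≤ 1 / 2 := by
        refine h1.trans ?_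
        rw [div_le_div_iff₀ (by linarith) two_pos]
        linarith
      gcongr
      exact hG
    refine (Finset.sum_le_card_nsmul _ _ _ hterm).trans ?_
    rw [nsmul_eq_mul, Finset.card_range]
    push_cast
    calc (s : ℝ) ^ 2 * (300 * n * blockCount (2 * n) * (1 / 2) ^ s)
        ≤ (s : ℝ) ^ 2 * (300 * (256 * s ^ 8) * blockCount (2 * n) * (1 / 2) ^ s) := by gcongr
      _ = _ := by ring
  have hmain' : (blockCount (2 * n - 2 * s ^ 3) : ℝ) ≤ rectP 2 n +
      ((∑ i ∈ Finset.Ioc (s ^ 5) (2 * n), blockCount (2 * n - i) : ℕ) : ℝ) +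
      ((∑ q ∈ Finset.range (s ^ 2), (partSet blockArea (blockParts (4 * n) \
      blockWindow (s ^ 3) s q) (2 * n)).ncard : ℕ) : ℝ) := by exact_mod_cast hmain
  rw [sub_le_iff_le_add, div_le_iff₀ hg, add_mul, div_mul_cancel₀ _ hg.ne', add_mul]
  linarith

lemma tendsto_rectP_two_div : Tendsto (fun n => (rectP 2 n : ℝ) / blockCount (2 * n))
    atTop (𝓝 1) := by
  have hs : Tendsto (fun n => (eighthRoot n : ℝ)) atTop atTop :=
    tendsto_natCast_atTop_atTop.comp tendsto_eighthRoot
  have e1 : Tendsto (fun n => 600 * 256 ^ 2 * (eighthRoot n : ℝ) ^ 16 *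
      Real.exp (-(eighthRoot n / 64))) atTop (𝓝 0) := by
    have := ((Real.tendsto_pow_mul_exp_neg_atTop_nhds_zero 16).comp
      (hs.atTop_div_const (by norm_num : (0 : ℝ) < 64))).const_mul (600 * 256 ^ 2 * 64 ^ 16)
    rw [mul_zero] at this
    refine this.congr fun n => ?_
    simp only [Function.comp_apply]
    ring
  have e2 : Tendsto (fun n => 300 * 256 * ((eighthRoot n : ℝ) ^ 10 * (1 / 2) ^ eighthRoot n))
      atTop (𝓝 0) := by
    have := ((tendsto_pow_const_mul_const_pow_of_abs_lt_one 10
      (by norm_num [abs_of_pos] : |(1 / 2 : ℝ)| < 1)).comp tendsto_eighthRoot).const_mul (300 * 256)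
    rw [mul_zero] at this
    exact this
  have hlow := tendsto_blockCount_sub_div.sub (e1.add e2)
  rw [add_zero, sub_zero] at hlow
  refine tendsto_of_tendsto_of_tendsto_of_le_of_le' hlow tendsto_const_nhds
    eventually_blockCount_div_le ?_
  refine Eventually.of_forall fun n => ?_
  exact div_le_one_of_le₀ (by exact_mod_cast rectP_two_le n) (Nat.cast_nonneg _)

end

section

open Filter Topology

lemma tendsto_rectP_two_add_div {h : ℕ → ℕ} {C : ℝ} (hh : ∀ᶠ n : ℕ in atTop, (h n : ℝ) ≤ C * √n) :
    Tendsto (fun n => rectP 2 (n + h n) * Real.exp (-(2 * saddlePoint n * h n)) / rectP 2 n)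
      atTop (𝓝 1) := by
  have h1 := tendsto_blockCount_div (κ := fun n => 2 * (n + h n)) (C := 2 * C) (by
    filter_upwards [hh] with n hn
    push_cast
    rw [show 2 * ((n : ℝ) + h n) - 2 * n = 2 * h n by ring, abs_of_nonneg (by positivity)]
    linarith)
  have h2 : Tendsto (fun n => (rectP 2 (n + h n) : ℝ) / blockCount (2 * (n + h n))) atTop (𝓝 1) :=
    tendsto_rectP_two_div.comp (tendsto_atTop_mono (fun n => Nat.le_add_right n (h n)) tendsto_id)
  have h3 := (h2.mul h1).div tendsto_rectP_two_div one_ne_zero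
  rw [mul_one, div_one] at h3
  refine h3.congr' ?_
  filter_upwards [eventually_gt_atTop 0] with n hn
  have hb : (blockCount (2 * n) : ℝ) ≠ 0 := by
    exact_mod_cast (blockCount_pos (show 0 < 2 * n by omega)).ne'
  have hb' : (blockCount (2 * (n + h n)) : ℝ) ≠ 0 := by
    exact_mod_cast (blockCount_pos (show 0 < 2 * (n + h n) by omega)).ne'
  have he : saddlePoint n * (((2 * (n + h n) : ℕ) : ℝ) - 2 * n) = 2 * saddlePoint n * h n := by
    push_cast
    ring
  simp only [Pi.div_apply]
  rw [he]
  field_simp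

lemma eventually_rectP_two_pos : ∀ᶠ n : ℕ in atTop, 0 < (rectP 2 n : ℝ) := by
  filter_upwards [tendsto_rectP_two_div.eventually_ne one_ne_zero] with n hn
  refine (Nat.cast_nonneg _).lt_of_ne' fun h0 => hn ?_
  rw [h0, zero_div]

lemma eventually_abs_log_rectP_two_sub_le (C : ℝ) {ε : ℝ} (hε : 0 < ε) :
    ∀ᶠ n : ℕ in atTop, ∀ h : ℕ, (h : ℝ) ≤ C * √n →
      |Real.log (rectP 2 (n + h)) - (Real.log (rectP 2 n) + h * (2 * saddlePoint n))| ≤ ε := by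
  by_contra hcon
  obtain ⟨P, hP⟩ : ∃ P : ℕ → ℕ → Prop, P = fun (n h : ℕ) => (h : ℝ) ≤ C * √n ∧
      ε < |Real.log (rectP 2 (n + h)) - (Real.log (rectP 2 n) + h * (2 * saddlePoint n))| :=
    ⟨_, rfl⟩
  have hfreq : ∃ᶠ n : ℕ in atTop, ∃ h, P n h := by
    simpa only [hP, Filter.Frequently, not_exists, not_and, not_lt] using! hcon
  classical
  set g : ℕ → ℕ := fun n => if hn : ∃ h, P n h then hn.choose else 0 with hg
  have hgP : ∀ n, (∃ h, P n h) → P n (g n) := fun n hn => by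
    simpa only [hg, dif_pos hn] using hn.choose_spec
  have hgle : ∀ n, (g n : ℝ) ≤ |C| * √n := fun n => by
    by_cases hn : ∃ h, P n h
    · have := hgP n hn
      rw [hP] at this
      exact this.1.trans (mul_le_mul_of_nonneg_right (le_abs_self C) (Real.sqrt_nonneg _))
    · simp only [hg, dif_neg hn, Nat.cast_zero]
      positivity
  have hlog := (tendsto_rectP_two_add_div (Eventually.of_forall hgle)).log one_ne_zero
  rw [Real.log_one] at hlog
  have hsmall := (tendsto_zero_iff_abs_tendsto_zero _).1 hlog |>.eventually_lt_const hε
  have hpos' : ∀ᶠ n : ℕ in atTop, 0 < (rectP 2 (n + g n) : ℝ) :=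
    (tendsto_atTop_mono (fun n => Nat.le_add_right n (g n)) tendsto_id).eventually
      eventually_rectP_two_pos
  refine hfreq ?_
  filter_upwards [hsmall, eventually_rectP_two_pos, hpos'] with n hn h0 h0' hex
  have h1 := hgP n hex
  rw [hP] at h1
  refine absurd h1.2 (not_lt.2 (le_of_eq_of_le ?_ hn.le))
  simp only [Function.comp_apply]
  rw [Real.log_div (by positivity) h0.ne', Real.log_mul h0'.ne' (Real.exp_pos _).ne', Real.log_exp]
  congr 1
  ring

end

/-- The sequence `p(2,n)` obeys Benford's Law in every integer base `b ≥ 2`: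
the fractional parts of `log_b p(2,n)` are equidistributed modulo 1. -/
theorem rectP_two_benford (b : ℕ) (hb : 2 ≤ b) (α β : ℝ)
    (hα : 0 ≤ α) (hαβ : α < β) (hβ : β ≤ 1) :
    Filter.Tendsto (fun N : ℕ =>
      (Nat.card {n : ℕ | 1 ≤ n ∧ n ≤ N ∧
          Int.fract (Real.logb b (rectP 2 n)) ∈ Set.Ico α β} : ℝ) / (N : ℝ))
      Filter.atTop (nhds (β - α)) := by
  have hL : 0 < Real.log b := Real.log_pos (by exact_mod_cast hb)
  have hd : ∀ n, 0 < 2 * saddlePoint n / Real.log b := fun n =>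
    div_pos (mul_pos two_pos (saddlePoint_pos n)) hL
  refine tendsto_card_fract_div (d := fun n => 2 * saddlePoint n / Real.log b)
    (Filter.Eventually.of_forall hd) ?_ ?_ (fun ε hε => ?_) hα hαβ hβ
  · simpa using (tendsto_saddlePoint.const_mul 2).div_const (Real.log b)
  · refine Filter.tendsto_atTop_mono' _ ?_
      (tendsto_sqrt_natCast.atTop_div_const (mul_pos two_pos hL))
    filter_upwards [Filter.eventually_ge_atTop 256] with n hn
    have h16 := sixteen_le_sqrt hn
    have ht := (saddlePoint_spec hn).1
    rw [div_le_iff₀ (by positivity)] at ht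
    have hsq : √(n : ℝ) * √n = n := Real.mul_self_sqrt (Nat.cast_nonneg n)
    rw [div_le_iff₀ (mul_pos two_pos hL),
      show n * (2 * saddlePoint n / Real.log b) * (2 * Real.log b) = n * (4 * saddlePoint n) by
        field_simp; ring]
    nlinarith [mul_le_mul_of_nonneg_left ht (Real.sqrt_nonneg (n : ℝ))]
  · filter_upwards [eventually_abs_log_rectP_two_sub_le (2 * Real.log b + 1) (mul_pos hε hL),
      Filter.eventually_ge_atTop 256] with n hn hn256 h hh
    have h16 := sixteen_le_sqrt hn256
    have ht := (saddlePoint_spec hn256).1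
    have ht0 := saddlePoint_pos n
    rw [div_le_iff₀ (by positivity)] at ht
    have hle : (h : ℝ) ≤ (2 * Real.log b + 1) * √n := by
      refine hh.trans ?_
      rw [add_mul, one_mul, one_div_div]
      refine add_le_add ?_ (by linarith)
      rw [div_le_iff₀ (by positivity)]
      nlinarith [mul_le_mul_of_nonneg_left ht hL.le]
    have := hn h hle
    rw [← div_le_iff₀ hL, ← abs_of_pos hL, ← abs_div] at this
    refine le_of_eq_of_le ?_ this
    simp only [Real.logb]
    congr 1
    field_simp
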